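/- arXiv:1406.2754 — 6 statements merged into one kernel-verified Lean document; each statement's English description precedes it below -/
import Mathlib

section
/- There exists a heavy-tailed distribution F on [0,∞) such that F ∈ 𝒥, F ∉ ℒ, F ∉ 𝒟, F ∉ 𝒟𝒦₁, and F is not weakly tail equivalent to any subexponential distribution G ∈ 𝒮. -/
open MeasureTheory Filter Set Topology

noncomputable section

/-- The (real-valued) tail function of a measure `F` on `ℝ`: `F̄(x) = F((x,∞))`. -/
def tail (F : Measure ℝ) (x : ℝ) : ℝ := (F (Set.Ioi x)).toReal

/-- A distribution: a Borel probability measure on `[0,∞)` with unbounded support. -/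
def IsDistribution (F : Measure ℝ) : Prop :=
  IsProbabilityMeasure F ∧ F (Set.Iio 0) = 0 ∧ ∀ x : ℝ, 0 < F (Set.Ioi x)

/-- The convolution `F*2` of `F` with itself: the law of `X₁ + X₂` for independent `X₁, X₂ ∼ F`. -/
def conv2 (F : Measure ℝ) : Measure ℝ := (F.prod F).map fun p => p.1 + p.2

/-- Heavy-tailed (class 𝒦): all exponential moments are infinite. -/
def HeavyTailed (F : Measure ℝ) : Prop :=
  ∀ a : ℝ, 0 < a → ∫⁻ y, ENNReal.ofReal (Real.exp (a * y)) ∂F = ⊤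

/-- Class 𝒪𝒮 (generalized subexponential): `limsup F̄*²(x)/F̄(x) < ∞`. -/
def MemOS (F : Measure ℝ) : Prop :=
  Filter.atTop.limsup (fun x : ℝ => conv2 F (Set.Ioi x) / F (Set.Ioi x)) < ⊤

/-- Class 𝒟𝒦ᶜ (strongly heavy-tailed): `e^{λx} F̄(x) → ∞` for every `λ > 0`. -/
def StronglyHeavyTailed (F : Measure ℝ) : Prop :=
  ∀ l : ℝ, 0 < l →
    Filter.Tendsto (fun x : ℝ => Real.exp (l * x) * tail F x) Filter.atTop Filter.atTop

/-- Class 𝒟𝒦₁: `x^δ F̄(x) → ∞` for some `δ > 0`. -/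
def MemDK1 (F : Measure ℝ) : Prop :=
  ∃ δ : ℝ, 0 < δ ∧
    Filter.Tendsto (fun x : ℝ => x ^ δ * tail F x) Filter.atTop Filter.atTop

/-- Class ℒ (long-tailed): `F̄(x-t)/F̄(x) → 1` for every `t > 0`. -/
def MemL (F : Measure ℝ) : Prop :=
  ∀ t : ℝ, 0 < t →
    Filter.Tendsto (fun x : ℝ => tail F (x - t) / tail F x) Filter.atTop (nhds 1)

/-- Class 𝒟 (dominatedly varying): `limsup F̄(x/2)/F̄(x) < ∞`. -/
def MemD (F : Measure ℝ) : Prop :=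
  Filter.atTop.limsup (fun x : ℝ => F (Set.Ioi (x / 2)) / F (Set.Ioi x)) < ⊤

/-- Class 𝒪ℒ (generalized long-tailed): `limsup F̄(x-t)/F̄(x) < ∞` for every `t > 0`. -/
def MemOL (F : Measure ℝ) : Prop :=
  ∀ t : ℝ, 0 < t →
    Filter.atTop.limsup (fun x : ℝ => F (Set.Ioi (x - t)) / F (Set.Ioi x)) < ⊤

/-- Class 𝒮 (subexponential): `F̄*²(x)/F̄(x) → 2`. -/
def MemS (F : Measure ℝ) : Prop :=
  Filter.Tendsto (fun x : ℝ => (conv2 F (Set.Ioi x)).toReal / tail F x)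
    Filter.atTop (nhds 2)

/-- Class 𝒥 (principle of a single big jump, for `n = 2`):
`lim_{K→∞} liminf_{x→∞} P(min(X₁,X₂) ≤ K | X₁+X₂ > x) = 1` for independent `X₁, X₂ ∼ F`. -/
def MemJ (F : Measure ℝ) : Prop :=
  Filter.Tendsto (fun K : ℝ => Filter.atTop.liminf (fun x : ℝ =>
      ((F.prod F) {p : ℝ × ℝ | min p.1 p.2 ≤ K ∧ x < p.1 + p.2}).toReal /
      ((F.prod F) {p : ℝ × ℝ | x < p.1 + p.2}).toReal))
    Filter.atTop (nhds 1)

/-- Weak tail equivalence: `0 < liminf F̄(x)/Ḡ(x) ≤ limsup F̄(x)/Ḡ(x) < ∞`. -/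
def WeakTailEquiv (F G : Measure ℝ) : Prop :=
  0 < Filter.atTop.liminf (fun x : ℝ => F (Set.Ioi x) / G (Set.Ioi x)) ∧
  Filter.atTop.limsup (fun x : ℝ => F (Set.Ioi x) / G (Set.Ioi x)) < ⊤

/-- Subadditivity of the square root, with the convention `√y = 0` for `y < 0`. -/
theorem sqrt_add_le_add_sqrt' (u : ℝ) {v : ℝ} (hv : 0 ≤ v) : √(u + v) ≤ √u + √v := by
  rcases le_total 0 u with hu | hu
  · rw [Real.sqrt_le_left (by positivity)]
    nlinarith [Real.sq_sqrt hu, Real.sq_sqrt hv, Real.sqrt_nonneg u, Real.sqrt_nonneg v,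
      mul_nonneg (Real.sqrt_nonneg u) (Real.sqrt_nonneg v)]
  · rw [Real.sqrt_eq_zero_of_nonpos hu, zero_add]
    exact Real.sqrt_le_sqrt (by linarith)

theorem sqrt_add_le_of_le {u v : ℝ} (hv : 0 ≤ v) (hvu : v ≤ u) : √(u + v) ≤ √u + √v / 2 := by
  rw [Real.sqrt_le_left (by positivity)]
  nlinarith [Real.sq_sqrt hv, Real.sq_sqrt (hv.trans hvu), Real.sqrt_nonneg v,
    mul_le_mul_of_nonneg_right (Real.sqrt_le_sqrt hvu) (Real.sqrt_nonneg v)]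

/-- A nondecreasing function which is `1/2`-Hölder with constant `1` and
has long plateaus at the heights `n²`, each followed by a copy of the square root. -/
def plateau (x : ℝ) : ℝ := ⨅ n : ℕ, ((n : ℝ) ^ 2 + √(x - (n : ℝ) ^ 6))

theorem plateau_le (n : ℕ) (x : ℝ) : plateau x ≤ (n : ℝ) ^ 2 + √(x - (n : ℝ) ^ 6) :=
  ciInf_le ⟨0, by rintro _ ⟨m, rfl⟩; positivity⟩ n

theorem plateau_le_sqrt (x : ℝ) : plateau x ≤ √x := by
  simpa using plateau_le 0 x

theorem plateau_nonneg (x : ℝ) : 0 ≤ plateau x :=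
  le_ciInf fun n => by positivity

theorem monotone_plateau : Monotone plateau := fun x y hxy =>
  le_ciInf fun n => (plateau_le n x).trans <| by gcongr

theorem plateau_add_le (u : ℝ) {v : ℝ} (hv : 0 ≤ v) : plateau (u + v) ≤ plateau u + √v := by
  rw [← sub_le_iff_le_add]
  refine le_ciInf fun n => ?_
  have h := sqrt_add_le_add_sqrt' (u - (n : ℝ) ^ 6) hv
  have h' := plateau_le n (u + v)
  rw [show u + v - (n : ℝ) ^ 6 = u - (n : ℝ) ^ 6 + v by ring] at h'
  linarith

theorem le_plateau_add {n : ℕ} (hn : 3 ≤ n) {t : ℝ} (ht : 0 ≤ t) (htn : √t ≤ 2 * n) :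
    plateau ((n : ℝ) ^ 6) + √t ≤ plateau ((n : ℝ) ^ 6 + t) := by
  have hle : plateau ((n : ℝ) ^ 6) ≤ (n : ℝ) ^ 2 := by
    have h := plateau_le n ((n : ℝ) ^ 6)
    rwa [sub_self, Real.sqrt_zero, add_zero] at h
  suffices h : (n : ℝ) ^ 2 + √t ≤ plateau ((n : ℝ) ^ 6 + t) by linarith
  refine le_ciInf fun m => ?_
  have hn3 : (3 : ℝ) ≤ n := by exact_mod_cast hn
  rcases lt_trichotomy m n with h | rfl | h
  · have hm : (m : ℝ) + 1 ≤ n := by exact_mod_cast h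
    have hm5 : (m : ℝ) ^ 5 ≤ (n : ℝ) ^ 5 := by gcongr
    have hgap : (n : ℝ) ^ 5 ≤ (n : ℝ) ^ 6 - (m : ℝ) ^ 6 := by
      nlinarith [mul_le_mul_of_nonneg_left hm5 (Nat.cast_nonneg (α := ℝ) m),
        mul_le_mul_of_nonneg_right hm (by positivity : (0 : ℝ) ≤ (n : ℝ) ^ 5)]
    have hpow : (n : ℝ) ^ 4 + 4 * (n : ℝ) ^ 3 ≤ (n : ℝ) ^ 5 := by
      have : (0 : ℝ) ≤ (n : ℝ) ^ 3 * ((n : ℝ) ^ 2 - n - 4) := by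
        apply mul_nonneg (by positivity)
        nlinarith
      nlinarith
    have hsq : (n : ℝ) ^ 2 + √t ≤ √((n : ℝ) ^ 6 + t - (m : ℝ) ^ 6) := by
      apply Real.le_sqrt_of_sq_le
      nlinarith [Real.sq_sqrt ht,
        mul_le_mul_of_nonneg_left htn (by positivity : (0 : ℝ) ≤ (n : ℝ) ^ 2)]
    nlinarith [sq_nonneg (m : ℝ)]
  · simp
  · have hm : (n : ℝ) + 1 ≤ m := by exact_mod_cast h
    nlinarith [Real.sqrt_nonneg ((n : ℝ) ^ 6 + t - (m : ℝ) ^ 6)]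

/-- The function `-log F̄` for the distribution constructed below. -/
def hazard (x : ℝ) : ℝ := 4 * √x + plateau x

theorem monotone_hazard : Monotone hazard := fun x y hxy => by
  have := monotone_plateau hxy
  unfold hazard
  gcongr

theorem four_mul_sqrt_le_hazard (x : ℝ) : 4 * √x ≤ hazard x :=
  le_add_of_nonneg_right (plateau_nonneg x)

theorem hazard_le (x : ℝ) : hazard x ≤ 5 * √x := by
  have := plateau_le_sqrt x
  unfold hazard
  linarith

theorem hazard_nonneg (x : ℝ) : 0 ≤ hazard x :=
  le_trans (by positivity) (four_mul_sqrt_le_hazard x)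

theorem hazard_of_nonpos {x : ℝ} (hx : x ≤ 0) : hazard x = 0 := by
  have := hazard_le x
  rw [Real.sqrt_eq_zero_of_nonpos hx, mul_zero] at this
  exact this.antisymm (hazard_nonneg x)

theorem hazard_add_le (u : ℝ) {v : ℝ} (hv : 0 ≤ v) : hazard (u + v) ≤ hazard u + 5 * √v := by
  have h1 := sqrt_add_le_add_sqrt' u hv
  have h2 := plateau_add_le u hv
  unfold hazard
  linarith

theorem hazard_add_le_of_le {u v : ℝ} (hv : 0 ≤ v) (hvu : v ≤ u) :
    hazard (u + v) ≤ hazard u + 3 * √v := by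
  have h1 := sqrt_add_le_of_le hv hvu
  have h2 := plateau_add_le u hv
  unfold hazard
  linarith

theorem eventually_hazard_add_sqrt_le {t : ℝ} (ht : 0 ≤ t) :
    ∀ᶠ n : ℕ in atTop, hazard ((n : ℝ) ^ 6) + √t ≤ hazard ((n : ℝ) ^ 6 + t) := by
  filter_upwards [eventually_ge_atTop 3, eventually_ge_atTop ⌈√t⌉₊] with n hn hnt
  have h1 := le_plateau_add hn ht (by linarith [Nat.ceil_le.1 hnt, Real.sqrt_nonneg t])
  have h2 : √((n : ℝ) ^ 6) ≤ √((n : ℝ) ^ 6 + t) := Real.sqrt_le_sqrt (by linarith)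
  unfold hazard
  linarith

theorem continuousWithinAt_hazard (x : ℝ) : ContinuousWithinAt hazard (Ici x) x := by
  have hlim : Tendsto (fun y => hazard x + 5 * √(y - x)) (𝓝[≥] x) (𝓝 (hazard x)) := by
    have : ContinuousAt (fun y => hazard x + 5 * √(y - x)) x := by fun_prop
    simpa [ContinuousAt] using this.tendsto.mono_left nhdsWithin_le_nhds
  refine tendsto_of_tendsto_of_tendsto_of_le_of_le' tendsto_const_nhds hlim ?_ ?_
  · filter_upwards [self_mem_nhdsWithin] with y hy using monotone_hazard hy
  · filter_upwards [self_mem_nhdsWithin] with y hy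
    simpa using hazard_add_le x (sub_nonneg.2 (mem_Ici.1 hy))

theorem tendsto_hazard : Tendsto hazard atTop atTop :=
  tendsto_atTop_mono four_mul_sqrt_le_hazard
    (Real.tendsto_sqrt_atTop.const_mul_atTop (by norm_num))

/-- The distribution function `x ↦ 1 - exp (-hazard x)`. -/
def hazardCDF : StieltjesFunction ℝ where
  toFun x := 1 - Real.exp (-hazard x)
  mono' x y hxy := by
    have := monotone_hazard hxy
    change 1 - Real.exp (-hazard x) ≤ 1 - Real.exp (-hazard y)
    gcongr
  right_continuous' x :=
    continuousWithinAt_const.sub (continuousWithinAt_hazard x).neg.rexp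

/-- The distribution on `[0, ∞)` with tail function `x ↦ exp (-hazard x)`. -/
def hazardLaw : Measure ℝ := hazardCDF.measure

theorem tendsto_hazardCDF_atTop : Tendsto hazardCDF atTop (𝓝 1) := by
  have : Tendsto (fun x => 1 - Real.exp (-hazard x)) atTop (𝓝 (1 - 0)) :=
    tendsto_const_nhds.sub
      (Real.tendsto_exp_atBot.comp (tendsto_neg_atTop_atBot.comp tendsto_hazard))
  rwa [sub_zero] at this

theorem tendsto_hazardCDF_atBot : Tendsto hazardCDF atBot (𝓝 0) := by
  refine tendsto_const_nhds.congr' ?_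
  filter_upwards [eventually_le_atBot 0] with x hx
  change 0 = 1 - Real.exp (-hazard x)
  simp [hazard_of_nonpos hx]

instance : IsProbabilityMeasure hazardLaw :=
  hazardCDF.isProbabilityMeasure tendsto_hazardCDF_atBot tendsto_hazardCDF_atTop

theorem hazardLaw_Ioi (x : ℝ) : hazardLaw (Ioi x) = ENNReal.ofReal (Real.exp (-hazard x)) := by
  rw [hazardLaw, hazardCDF.measure_Ioi tendsto_hazardCDF_atTop]
  congr 1
  change 1 - (1 - Real.exp (-hazard x)) = _
  ring

theorem hazardLaw_Iio_zero : hazardLaw (Iio 0) = 0 := by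
  refine measure_mono_null Iio_subset_Iic_self ?_
  rw [hazardLaw, hazardCDF.measure_Iic tendsto_hazardCDF_atBot]
  change ENNReal.ofReal (1 - Real.exp (-hazard 0) - 0) = 0
  simp [hazard_of_nonpos le_rfl]

theorem tail_hazardLaw (x : ℝ) : tail hazardLaw x = Real.exp (-hazard x) := by
  rw [tail, hazardLaw_Ioi, ENNReal.toReal_ofReal (Real.exp_nonneg _)]

theorem isDistribution_hazardLaw : IsDistribution hazardLaw :=
  ⟨inferInstance, hazardLaw_Iio_zero, fun x => by
    rw [hazardLaw_Ioi]; exact ENNReal.ofReal_pos.2 (Real.exp_pos _)⟩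

theorem hazardLaw_Ioi_div (x y : ℝ) : hazardLaw (Ioi x) / hazardLaw (Ioi y) =
    ENNReal.ofReal (Real.exp (hazard y - hazard x)) := by
  rw [hazardLaw_Ioi, hazardLaw_Ioi, ← ENNReal.ofReal_div_of_pos (Real.exp_pos _), ← Real.exp_sub]
  ring_nf

theorem heavyTailed_hazardLaw : HeavyTailed hazardLaw := by
  intro a ha
  have hlim : Tendsto (fun x : ℝ => √x * (a * √x + -5)) atTop atTop :=
    Real.tendsto_sqrt_atTop.atTop_mul_atTop₀
      (tendsto_atTop_add_const_right _ _ (Real.tendsto_sqrt_atTop.const_mul_atTop ha))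
  have hlim' := ENNReal.tendsto_ofReal_atTop.comp (Real.tendsto_exp_atTop.comp hlim)
  refine top_le_iff.1 (le_of_tendsto hlim' ?_)
  filter_upwards [eventually_ge_atTop 0] with x hx
  calc ENNReal.ofReal (Real.exp (√x * (a * √x + -5)))
      ≤ ENNReal.ofReal (Real.exp (a * x)) * hazardLaw (Ioi x) := by
        rw [hazardLaw_Ioi, ← ENNReal.ofReal_mul (Real.exp_nonneg _), ← Real.exp_add]
        gcongr
        nlinarith [hazard_le x, Real.sq_sqrt hx]
    _ ≤ ENNReal.ofReal (Real.exp (a * x)) * hazardLaw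
          {y | ENNReal.ofReal (Real.exp (a * x)) ≤ ENNReal.ofReal (Real.exp (a * y))} := by
        gcongr
        intro y hy
        have : x ≤ y := le_of_lt hy
        simp only [mem_ofPred_eq]
        gcongr
    _ ≤ ∫⁻ y, ENNReal.ofReal (Real.exp (a * y)) ∂hazardLaw :=
        mul_meas_ge_le_lintegral (by fun_prop) _

theorem not_memD_hazardLaw : ¬ MemD hazardLaw := by
  have hlim : Tendsto (fun x : ℝ => √x) atTop atTop := Real.tendsto_sqrt_atTop
  have hdiff : Tendsto (fun x : ℝ => hazard x - hazard (x / 2)) atTop atTop := by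
    refine tendsto_atTop_mono' _ ?_ hlim
    filter_upwards [eventually_ge_atTop 0] with x hx
    have h1 := monotone_plateau (by linarith : x / 2 ≤ x)
    have h2 : √(x / 2) ≤ 3 / 4 * √x := by
      rw [Real.sqrt_le_left (by positivity), mul_pow, Real.sq_sqrt hx]
      linarith
    unfold hazard
    linarith
  have : Tendsto (fun x : ℝ => hazardLaw (Ioi (x / 2)) / hazardLaw (Ioi x)) atTop (𝓝 ⊤) := by
    simp only [hazardLaw_Ioi_div]
    exact ENNReal.tendsto_ofReal_atTop.comp (Real.tendsto_exp_atTop.comp hdiff)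
  simp [MemD, this.limsup_eq]

theorem not_memDK1_hazardLaw : ¬ MemDK1 hazardLaw := by
  rintro ⟨δ, -, h⟩
  have hlim : Tendsto (fun x : ℝ => √x ^ (2 * δ) * Real.exp (-4 * √x)) atTop (𝓝 0) :=
    (tendsto_rpow_mul_exp_neg_mul_atTop_nhds_zero (2 * δ) 4 (by norm_num)).comp
      Real.tendsto_sqrt_atTop
  refine not_tendsto_nhds_of_tendsto_atTop h 0 (squeeze_zero' ?_ ?_ hlim)
  · filter_upwards [eventually_ge_atTop 0] with x hx
    rw [tail_hazardLaw]
    positivity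
  · filter_upwards [eventually_ge_atTop 0] with x hx
    have : √x ^ (2 * δ) = x ^ δ := by
      rw [Real.sqrt_eq_rpow, ← Real.rpow_mul hx]
      congr 1
      ring
    rw [this, tail_hazardLaw]
    gcongr
    linarith [four_mul_sqrt_le_hazard x]

theorem tendsto_pow_six_add_atTop (t : ℝ) :
    Tendsto (fun n : ℕ => (n : ℝ) ^ 6 + t) atTop atTop :=
  tendsto_atTop_add_const_right _ _
    ((tendsto_pow_atTop (by norm_num)).comp tendsto_natCast_atTop_atTop)

theorem exp_sqrt_le_of_eventually_tail_sub_le {t C : ℝ} (ht : 0 ≤ t)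
    (h : ∀ᶠ x in atTop, tail hazardLaw (x - t) ≤ C * tail hazardLaw x) : Real.exp √t ≤ C := by
  obtain ⟨n, h1, h2⟩ := ((eventually_hazard_add_sqrt_le ht).and
    ((tendsto_pow_six_add_atTop t).eventually h)).exists
  rw [add_sub_cancel_right, tail_hazardLaw, tail_hazardLaw,
    ← div_le_iff₀ (Real.exp_pos _), ← Real.exp_sub] at h2
  refine le_trans (Real.exp_le_exp.2 ?_) h2
  linarith

theorem not_memL_hazardLaw : ¬ MemL hazardLaw := by
  intro h
  have h1 : ∀ᶠ x in atTop, tail hazardLaw (x - 1) ≤ 2 * tail hazardLaw x := by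
    filter_upwards [(h 1 one_pos).eventually_le_const one_lt_two] with x hx
    rwa [div_le_iff₀ (by rw [tail_hazardLaw]; exact Real.exp_pos _)] at hx
  have h2 := exp_sqrt_le_of_eventually_tail_sub_le zero_le_one h1
  rw [Real.sqrt_one] at h2
  linarith [Real.exp_one_gt_d9]

theorem IsDistribution.tail_pos {G : Measure ℝ} (hG : IsDistribution G) (x : ℝ) :
    0 < tail G x := by
  have := hG.1
  exact ENNReal.toReal_pos (hG.2.2 x).ne' (measure_ne_top G _)

theorem tendsto_measure_Ioi_atTop_zero (G : Measure ℝ) [IsFiniteMeasure G] :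
    Tendsto (fun x => G (Ioi x)) atTop (𝓝 0) := by
  have h := tendsto_measure_iInter_atTop (μ := G) (s := fun x : ℝ => Ioi x)
    (fun x => measurableSet_Ioi.nullMeasurableSet) (fun x y hxy => Ioi_subset_Ioi hxy)
    ⟨0, measure_ne_top G _⟩
  have hempty : ⋂ x : ℝ, Ioi x = ∅ :=
    eq_empty_of_forall_notMem fun y hy => lt_irrefl y (mem_iInter.1 hy y)
  rwa [hempty, measure_empty] at h

theorem IsDistribution.measure_Ici_zero {G : Measure ℝ} (hG : IsDistribution G) :
    G (Ici 0) = 1 := by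
  have := hG.1
  rw [← compl_Iio, prob_compl_eq_one_sub measurableSet_Iio, hG.2.1, tsub_zero]

theorem measurableSet_lt_add (x : ℝ) : MeasurableSet {p : ℝ × ℝ | x < p.1 + p.2} :=
  measurableSet_lt measurable_const (by fun_prop)

/-- Lower bound for the tail of `G*2`: split according to the value of the first summand. -/
theorem IsDistribution.le_conv2_Ioi {G : Measure ℝ} (hG : IsDistribution G) {t x : ℝ}
    (htx : t ≤ x) :
    G (Ioi x) + G (Icc 0 t) * G (Ioi x) + G (Ioc t x) * G (Ioi (x - t)) ≤ conv2 G (Ioi x) := by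
  have := hG.1
  rw [conv2, Measure.map_apply (by fun_prop) measurableSet_Ioi]
  have hA : G (Ioi x) = (G.prod G) (Ioi x ×ˢ Ici 0) := by
    rw [Measure.prod_prod, hG.measure_Ici_zero, mul_one]
  rw [← Measure.prod_prod, ← Measure.prod_prod, hA, ← measure_union, ← measure_union]
  · refine measure_mono ?_
    rintro ⟨a, b⟩ h
    simp only [mem_union, mem_prod, mem_Ioi, mem_Ici, mem_Icc, mem_Ioc, mem_preimage] at h ⊢
    rcases h with (h | h) | h <;> linarith
  · rw [Set.disjoint_left]
    rintro ⟨a, b⟩ h h'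
    simp only [mem_union, mem_prod, mem_Ioi, mem_Ici, mem_Icc, mem_Ioc] at h h'
    rcases h with h | h <;> linarith
  · exact measurableSet_Ioc.prod measurableSet_Ioi
  · rw [Set.disjoint_left]
    rintro ⟨a, b⟩ h h'
    simp only [mem_prod, mem_Ioi, mem_Ici, mem_Icc] at h h'
    linarith
  · exact measurableSet_Icc.prod measurableSet_Ioi

theorem IsDistribution.le_conv2_toReal {G : Measure ℝ} (hG : IsDistribution G) {t x : ℝ}
    (htx : t ≤ x) :
    tail G x + (1 - tail G t) * tail G x + (tail G t - tail G x) * tail G (x - t) ≤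
      (conv2 G (Ioi x)).toReal := by
  have := hG.1
  have : IsProbabilityMeasure (conv2 G) := Measure.isProbabilityMeasure_map (by fun_prop)
  have h := ENNReal.toReal_mono (measure_ne_top (conv2 G) _) (hG.le_conv2_Ioi htx)
  rw [ENNReal.toReal_add (by finiteness) (by finiteness),
    ENNReal.toReal_add (by finiteness) (by finiteness), ENNReal.toReal_mul,
    ENNReal.toReal_mul] at h
  have h1 : 1 - tail G t ≤ (G (Icc 0 t)).toReal := by
    have : G (Ici 0) ≤ G (Icc 0 t) + G (Ioi t) := by
      refine (measure_mono ?_).trans (measure_union_le _ _)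
      intro y hy
      rcases le_or_gt y t with h | h
      · exact Or.inl ⟨hy, h⟩
      · exact Or.inr h
    rw [hG.measure_Ici_zero] at this
    have := ENNReal.toReal_mono (by finiteness) this
    rw [ENNReal.toReal_add (by finiteness) (by finiteness), ENNReal.toReal_one] at this
    rw [tail]
    linarith
  have h2 : (G (Ioc t x)).toReal = tail G t - tail G x := by
    have : G (Ioi t) = G (Ioc t x) + G (Ioi x) := by
      rw [← measure_union (by
        rw [Set.disjoint_left]; intro y hy hy'; exact absurd hy.2 (not_le.2 hy'))
        measurableSet_Ioi, Ioc_union_Ioi_eq_Ioi htx]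
    rw [tail, this, ENNReal.toReal_add (by finiteness) (by finiteness), tail]
    ring
  rw [h2] at h
  have h3 := mul_le_mul_of_nonneg_right h1 (hG.tail_pos x).le
  change tail G x + _ * tail G x + _ * tail G (x - t) ≤ _ at h
  linarith

/-- Long-tailedness of subexponential distributions, in the weak form of a bound on
`Ḡ(x - t) / Ḡ(x)` which does not depend on `t`. -/
theorem MemS.eventually_tail_sub_le {G : Measure ℝ} (hG : IsDistribution G) (hS : MemS G)
    (t : ℝ) : ∀ᶠ x in atTop, tail G (x - t) ≤ 2 * tail G x := by
  have := hG.1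
  have ht := hG.tail_pos t
  have hzero : Tendsto (tail G) atTop (𝓝 0) := by
    exact (ENNReal.tendsto_toReal ENNReal.zero_ne_top).comp (tendsto_measure_Ioi_atTop_zero G)
  filter_upwards [hS.eventually_le_const (by linarith : (2 : ℝ) < 2 + tail G t / 4),
    hzero.eventually_le_const (by linarith : 0 < tail G t / 4), eventually_ge_atTop t]
    with x h1 h2 htx
  have hx := hG.tail_pos x
  have h3 := hG.le_conv2_toReal htx
  rw [div_le_iff₀ hx] at h1
  have h4 : 3 / 4 * tail G t * tail G (x - t) ≤ (tail G t - tail G x) * tail G (x - t) := by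
    gcongr
    · exact (hG.tail_pos _).le
    · linarith
  have h5 : tail G t * (3 / 4 * tail G (x - t)) ≤ tail G t * (5 / 4 * tail G x) := by linarith
  have h6 := le_of_mul_le_mul_left h5 ht
  linarith

theorem WeakTailEquiv.exists_eventually {F G : Measure ℝ} (hF : IsDistribution F)
    (hG : IsDistribution G) (h : WeakTailEquiv F G) :
    ∃ c C : ℝ, 0 < c ∧ 0 < C ∧
      ∀ᶠ x in atTop, c * tail G x ≤ tail F x ∧ tail F x ≤ C * tail G x := by
  have := hF.1
  have := hG.1
  obtain ⟨c, hc0, hc⟩ := exists_between h.1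
  obtain ⟨C, hC, hCtop⟩ := exists_between h.2
  have hev : ∀ᶠ x in atTop, c.toReal * tail G x ≤ tail F x ∧ tail F x ≤ C.toReal * tail G x := by
    filter_upwards [eventually_lt_of_lt_liminf hc, eventually_lt_of_limsup_lt hC] with x h1 h2
    have hGx := hG.tail_pos x
    have hfin : F (Ioi x) / G (Ioi x) ≠ ⊤ :=
      ENNReal.div_ne_top (measure_ne_top F _) (hG.2.2 x).ne'
    have h1' := ENNReal.toReal_mono hfin h1.le
    have h2' := ENNReal.toReal_mono hCtop.ne h2.le
    rw [ENNReal.toReal_div] at h1' h2'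
    exact ⟨(le_div_iff₀ hGx).1 h1', (div_le_iff₀ hGx).1 h2'⟩
  refine ⟨c.toReal, C.toReal, ENNReal.toReal_pos hc0.ne' (hc.trans_le le_top).ne, ?_, hev⟩
  obtain ⟨x, -, hx⟩ := hev.exists
  exact pos_of_mul_pos_left ((hF.tail_pos x).trans_le hx) (hG.tail_pos x).le

theorem not_weakTailEquiv_hazardLaw {G : Measure ℝ} (hG : IsDistribution G) (hS : MemS G) :
    ¬ WeakTailEquiv hazardLaw G := by
  intro h
  obtain ⟨c, C, hc, hC, hev⟩ := h.exists_eventually isDistribution_hazardLaw hG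
  have hbound : ∀ t : ℝ, 0 ≤ t → Real.exp √t ≤ C * 2 / c := by
    intro t ht
    refine exp_sqrt_le_of_eventually_tail_sub_le ht ?_
    filter_upwards [hev, (tendsto_atTop_add_const_right _ (-t) tendsto_id).eventually hev,
      hS.eventually_tail_sub_le hG t] with x h1 h2 h3
    calc tail hazardLaw (x - t) ≤ C * tail G (x - t) := h2.2
      _ ≤ C * (2 * tail G x) := by gcongr
      _ = C * 2 / c * (c * tail G x) := by field_simp
      _ ≤ C * 2 / c * tail hazardLaw x := by gcongr; exact h1.1
  have h1 := hbound ((C * 2 / c) ^ 2) (by positivity)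
  rw [Real.sqrt_sq (by positivity)] at h1
  linarith [Real.add_one_le_exp (C * 2 / c)]

theorem lintegral_exp_sqrt_ne_top :
    ∫⁻ y, ENNReal.ofReal (Real.exp (3 * √y)) ∂hazardLaw ≠ ⊤ := by
  have hmeas (m : ℕ) : MeasurableSet {y : ℝ | (m : ℝ) ≤ √y} :=
    measurableSet_le measurable_const (by fun_prop)
  have hle (m : ℕ) : hazardLaw {y : ℝ | (m : ℝ) ≤ √y} ≤
      ENNReal.ofReal (Real.exp (-4 * (m - 1))) := by
    rcases Nat.eq_zero_or_pos m with rfl | hm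
    · refine prob_le_one.trans ?_
      rw [ENNReal.one_le_ofReal]
      exact Real.one_le_exp (by norm_num)
    · have hm1 : (1 : ℝ) ≤ m := by exact_mod_cast hm
      refine (measure_mono (t := Ioi (((m : ℝ) - 1) ^ 2)) ?_).trans ?_
      · intro y hy
        have hy' : (m : ℝ) ≤ √y := hy
        have := Real.lt_sqrt (by linarith) |>.1 (by linarith : (m : ℝ) - 1 < √y)
        exact this
      · rw [hazardLaw_Ioi]
        gcongr
        have := four_mul_sqrt_le_hazard (((m : ℝ) - 1) ^ 2)
        rw [Real.sqrt_sq (by linarith)] at this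
        linarith
  have hsum : ∑' m : ℕ, ENNReal.ofReal (Real.exp 7 * Real.exp (-m)) ≠ ⊤ :=
    (Real.summable_exp_neg_nat.mul_left _).tsum_ofReal_ne_top
  refine ne_top_of_le_ne_top hsum ?_
  calc ∫⁻ y, ENNReal.ofReal (Real.exp (3 * √y)) ∂hazardLaw
      ≤ ∫⁻ y, ∑' m : ℕ, {y : ℝ | (m : ℝ) ≤ √y}.indicator
          (fun _ => ENNReal.ofReal (Real.exp (3 * (m + 1)))) y ∂hazardLaw := by
        refine lintegral_mono fun y => ?_
        refine le_trans ?_ (ENNReal.le_tsum ⌊√y⌋₊)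
        rw [indicator_of_mem (by exact Nat.floor_le (Real.sqrt_nonneg y))]
        gcongr
        exact (Nat.lt_floor_add_one _).le
    _ = ∑' m : ℕ, ENNReal.ofReal (Real.exp (3 * (m + 1))) *
          hazardLaw {y : ℝ | (m : ℝ) ≤ √y} := by
        rw [lintegral_tsum fun m => (measurable_const.indicator (hmeas m)).aemeasurable]
        simp_rw [lintegral_indicator_const (hmeas _)]
    _ ≤ ∑' m : ℕ, ENNReal.ofReal (Real.exp 7 * Real.exp (-m)) := by
        refine ENNReal.tsum_le_tsum fun m => ?_
        refine (mul_le_mul_right (hle m) _).trans ?_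
        rw [← ENNReal.ofReal_mul (Real.exp_nonneg _), ← Real.exp_add, ← Real.exp_add]
        refine ENNReal.ofReal_le_ofReal (Real.exp_le_exp.2 ?_)
        linarith

/-- The contribution of `K < X₁ ≤ x / 2` to the event `X₁ + X₂ > x`. -/
theorem prod_lower_half_le {K : ℝ} (hK : 0 ≤ K) (x : ℝ) :
    (hazardLaw.prod hazardLaw) {p | K < p.1 ∧ p.1 ≤ x / 2 ∧ x < p.1 + p.2} ≤
      (∫⁻ y in Ioi K, ENNReal.ofReal (Real.exp (3 * √y)) ∂hazardLaw) * hazardLaw (Ioi x) := by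
  have hmeas : MeasurableSet {p : ℝ × ℝ | K < p.1 ∧ p.1 ≤ x / 2 ∧ x < p.1 + p.2} :=
    (measurableSet_lt measurable_const measurable_fst).inter
      ((measurableSet_le measurable_fst measurable_const).inter (measurableSet_lt_add x))
  rw [Measure.prod_apply hmeas, ← lintegral_mul_const _ (by fun_prop),
    ← lintegral_indicator measurableSet_Ioi]
  refine lintegral_mono fun y => ?_
  by_cases hy : K < y ∧ y ≤ x / 2
  · rw [indicator_of_mem (by exact hy.1), hazardLaw_Ioi, ← ENNReal.ofReal_mul (Real.exp_nonneg _),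
      ← Real.exp_add]
    calc hazardLaw (Prod.mk y ⁻¹' {p | K < p.1 ∧ p.1 ≤ x / 2 ∧ x < p.1 + p.2})
        ≤ hazardLaw (Ioi (x - y)) := by
          refine measure_mono fun z hz => ?_
          have : x < y + z := hz.2.2
          exact sub_lt_iff_lt_add'.2 this
      _ ≤ _ := by
          rw [hazardLaw_Ioi]
          gcongr
          have := hazard_add_le_of_le (u := x - y) (v := y) (by linarith) (by linarith)
          rw [sub_add_cancel] at this
          linarith
  · refine le_of_eq_of_le ?_ zero_le
    convert measure_empty (μ := hazardLaw)
    exact eq_empty_of_forall_notMem fun z hz => hy ⟨hz.1, hz.2.1⟩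

theorem hazardLaw_half_mul_self_le {K x : ℝ} (hx : 2 * K ≤ x) (hK : 0 ≤ K) :
    hazardLaw (Ioi (x / 2)) * hazardLaw (Ioi (x / 2)) ≤
      ENNReal.ofReal (Real.exp (-√K)) * hazardLaw (Ioi x) := by
  rw [hazardLaw_Ioi, hazardLaw_Ioi, ← ENNReal.ofReal_mul (Real.exp_nonneg _),
    ← ENNReal.ofReal_mul (Real.exp_nonneg _), ← Real.exp_add, ← Real.exp_add]
  refine ENNReal.ofReal_le_ofReal (Real.exp_le_exp.2 ?_)
  have h1 := hazard_add_le_of_le (u := x / 2) (v := x / 2) (by linarith) le_rfl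
  rw [add_halves] at h1
  have h2 := four_mul_sqrt_le_hazard (x / 2)
  have h3 : √K ≤ √(x / 2) := Real.sqrt_le_sqrt (by linarith)
  linarith

/-- Twice the exponential square root moment on `(K, ∞)` plus `exp (-√K)`, which bounds the
probability of two big summands relative to the tail. -/
def twoJumpBound (K : ℝ) : ENNReal :=
  2 * (∫⁻ y in Ioi K, ENNReal.ofReal (Real.exp (3 * √y)) ∂hazardLaw) +
    ENNReal.ofReal (Real.exp (-√K))

theorem tendsto_twoJumpBound : Tendsto twoJumpBound atTop (𝓝 0) := by
  have h1 : Tendsto (fun K : ℝ => ∫⁻ y in Ioi K, ENNReal.ofReal (Real.exp (3 * √y)) ∂hazardLaw)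
      atTop (𝓝 0) :=
    tendsto_setLIntegral_zero lintegral_exp_sqrt_ne_top (tendsto_measure_Ioi_atTop_zero _)
  have h2 : Tendsto (fun K : ℝ => ENNReal.ofReal (Real.exp (-√K))) atTop (𝓝 0) := by
    simpa using ENNReal.tendsto_ofReal (Real.tendsto_exp_atBot.comp
      (tendsto_neg_atTop_atBot.comp Real.tendsto_sqrt_atTop))
  unfold twoJumpBound
  simpa using
    (ENNReal.Tendsto.const_mul h1 (Or.inr ENNReal.ofNat_ne_top)).add h2

theorem twoJumpBound_ne_top (K : ℝ) : twoJumpBound K ≠ ⊤ :=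
  ENNReal.add_ne_top.2 ⟨ENNReal.mul_ne_top ENNReal.ofNat_ne_top
    (ne_top_of_le_ne_top lintegral_exp_sqrt_ne_top (setLIntegral_le_lintegral _ _)),
    ENNReal.ofReal_ne_top⟩

theorem prod_two_jumps_le {K x : ℝ} (hK : 0 ≤ K) (hx : 2 * K ≤ x) :
    (hazardLaw.prod hazardLaw) {p | K < p.1 ∧ K < p.2 ∧ x < p.1 + p.2} ≤
      twoJumpBound K * hazardLaw (Ioi x) := by
  set A : Set (ℝ × ℝ) := {p | K < p.1 ∧ p.1 ≤ x / 2 ∧ x < p.1 + p.2}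
  have hA : MeasurableSet A :=
    (measurableSet_lt measurable_const measurable_fst).inter
      ((measurableSet_le measurable_fst measurable_const).inter (measurableSet_lt_add x))
  have hswap : (hazardLaw.prod hazardLaw) (Prod.swap ⁻¹' A) = (hazardLaw.prod hazardLaw) A := by
    rw [← Measure.map_apply measurable_swap hA, Measure.prod_swap]
  have hsub : {p : ℝ × ℝ | K < p.1 ∧ K < p.2 ∧ x < p.1 + p.2} ⊆
      A ∪ Prod.swap ⁻¹' A ∪ Ioi (x / 2) ×ˢ Ioi (x / 2) := by
    rintro ⟨a, b⟩ ⟨ha, hb, hab⟩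
    rcases le_or_gt a (x / 2) with h | h
    · exact Or.inl (Or.inl ⟨ha, h, hab⟩)
    rcases le_or_gt b (x / 2) with h' | h'
    · exact Or.inl (Or.inr ⟨hb, h', by simpa [add_comm] using hab⟩)
    · exact Or.inr ⟨h, h'⟩
  calc _ ≤ (hazardLaw.prod hazardLaw) A + (hazardLaw.prod hazardLaw) (Prod.swap ⁻¹' A) +
          (hazardLaw.prod hazardLaw) (Ioi (x / 2) ×ˢ Ioi (x / 2)) :=
        (measure_mono hsub).trans <| (measure_union_le _ _).trans <| by
          gcongr
          exact measure_union_le _ _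
    _ ≤ _ := by
        rw [hswap, Measure.prod_prod, twoJumpBound, add_mul, two_mul, add_mul]
        have h := prod_lower_half_le hK x
        exact add_le_add (add_le_add h h) (hazardLaw_half_mul_self_le hx hK)

theorem memJ_hazardLaw : MemJ hazardLaw := by
  set P := hazardLaw.prod hazardLaw
  have hsum (x : ℝ) : hazardLaw (Ioi x) ≤ P {p | x < p.1 + p.2} := by
    calc hazardLaw (Ioi x) = P (Ioi x ×ˢ Ici 0) := by
          rw [Measure.prod_prod, isDistribution_hazardLaw.measure_Ici_zero, mul_one]
      _ ≤ _ := by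
          refine measure_mono ?_
          rintro ⟨a, b⟩ ⟨ha, hb⟩
          exact lt_of_lt_of_le ha (le_add_of_nonneg_right (mem_Ici.1 hb))
  have hpos (x : ℝ) : 0 < (P {p | x < p.1 + p.2}).toReal :=
    ENNReal.toReal_pos ((isDistribution_hazardLaw.2.2 x).trans_le (hsum x)).ne'
      (measure_ne_top P _)
  have hle (K x : ℝ) : (P {p | min p.1 p.2 ≤ K ∧ x < p.1 + p.2}).toReal /
      (P {p | x < p.1 + p.2}).toReal ≤ 1 := by
    refine div_le_one_of_le₀ (ENNReal.toReal_mono (measure_ne_top P _) ?_) (hpos x).le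
    exact measure_mono fun p hp => hp.2
  have hge {K x : ℝ} (hK : 0 ≤ K) (hx : 2 * K ≤ x) : 1 - (twoJumpBound K).toReal ≤
      (P {p | min p.1 p.2 ≤ K ∧ x < p.1 + p.2}).toReal / (P {p | x < p.1 + p.2}).toReal := by
    rw [le_div_iff₀ (hpos x), sub_mul, one_mul, sub_le_iff_le_add, ← ENNReal.toReal_mul,
      ← ENNReal.toReal_add (measure_ne_top P _)
        (ENNReal.mul_ne_top (twoJumpBound_ne_top K) (measure_ne_top P _))]
    refine ENNReal.toReal_mono (ENNReal.add_ne_top.2 ⟨measure_ne_top P _,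
      ENNReal.mul_ne_top (twoJumpBound_ne_top K) (measure_ne_top P _)⟩) ?_
    calc P {p | x < p.1 + p.2}
        ≤ P {p | min p.1 p.2 ≤ K ∧ x < p.1 + p.2} +
          P {p | K < p.1 ∧ K < p.2 ∧ x < p.1 + p.2} := by
          refine (measure_mono ?_).trans (measure_union_le _ _)
          intro p hp
          rcases le_or_gt (min p.1 p.2) K with h | h
          · exact Or.inl ⟨h, hp⟩
          · exact Or.inr ⟨(lt_min_iff.1 h).1, (lt_min_iff.1 h).2, hp⟩
      _ ≤ _ := by
          gcongr
          refine (prod_two_jumps_le hK hx).trans ?_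
          gcongr
          exact hsum x
  have hlim : Tendsto (fun K => 1 - (twoJumpBound K).toReal) atTop (𝓝 1) := by
    simpa using ((ENNReal.tendsto_toReal ENNReal.zero_ne_top).comp
      tendsto_twoJumpBound).const_sub 1
  refine tendsto_of_tendsto_of_tendsto_of_le_of_le' hlim tendsto_const_nhds ?_ ?_
  · filter_upwards [eventually_ge_atTop 0] with K hK
    refine le_liminf_of_le (isBoundedUnder_of ⟨1, hle K⟩).isCoboundedUnder_ge ?_
    filter_upwards [eventually_ge_atTop (2 * K)] with x hx using hge hK hx
  · filter_upwards with K
    refine liminf_le_of_le (isBoundedUnder_of ⟨0, fun x => by positivity⟩) fun b hb => ?_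
    obtain ⟨x, hx⟩ := hb.exists
    exact hx.trans (hle K x)

/-- there is a heavy-tailed `F ∈ 𝒥 \ (ℒ ∪ 𝒟)` with `F ∉ 𝒟𝒦₁` which is
not weakly tail equivalent to any subexponential distribution. -/
theorem exists_J_not_L_not_D_not_DK1_not_weakEquiv_subexp :
    ∃ F : Measure ℝ, IsDistribution F ∧ HeavyTailed F ∧ MemJ F ∧
      ¬ MemL F ∧ ¬ MemD F ∧ ¬ MemDK1 F ∧
      ¬ ∃ G : Measure ℝ, IsDistribution G ∧ MemS G ∧ WeakTailEquiv F G := by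
  exact ⟨hazardLaw, isDistribution_hazardLaw, heavyTailed_hazardLaw, memJ_hazardLaw,
    not_memL_hazardLaw, not_memD_hazardLaw, not_memDK1_hazardLaw,
    fun ⟨_, hG, hS, h⟩ => not_weakTailEquiv_hazardLaw hG hS h⟩
end
end

section
/- Let F be a distribution on [0,∞) satisfying limsup_{t→∞} limsup_{x→∞} F̄(x−t)/F̄(x) = ∞. Then F is not weakly tail equivalent to any long-tailed distribution: there is no distribution G ∈ ℒ with 0 < liminf_{x→∞} G̅(x)/F̄(x) ≤ limsup_{x→∞} G̅(x)/F̄(x) < ∞. -/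
open MeasureTheory Filter Set Topology

noncomputable section

/-- Long-tailedness bounds the shifted tail by twice the tail, eventually. -/
theorem MemL.eventually_measure_Ioi_sub_le {G : Measure ℝ} (hG : IsDistribution G) (hL : MemL G)
    {t : ℝ} (ht : 0 < t) : ∀ᶠ x : ℝ in atTop, G (Ioi (x - t)) ≤ 2 * G (Ioi x) := by
  obtain ⟨_, -, hpos⟩ := hG
  filter_upwards [(hL t ht).eventually_lt_const one_lt_two] with x hx
  have htail : 0 < tail G x := ENNReal.toReal_pos (hpos x).ne' (measure_ne_top G _)
  have hle : tail G (x - t) ≤ 2 * tail G x := ((div_lt_iff₀ htail).1 hx).le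
  have hfin : 2 * G (Ioi x) ≠ ⊤ := ENNReal.mul_ne_top (by simp) (measure_ne_top G _)
  rw [← ENNReal.toReal_le_toReal (measure_ne_top G _) hfin, ENNReal.toReal_mul]
  simpa [tail] using hle

/-- A distribution that is weakly tail equivalent to a long-tailed one has shifted tail ratios whose
upper limits are bounded uniformly in the shift. -/
theorem WeakTailEquiv.exists_limsup_ratio_le {F G : Measure ℝ} (hF : IsDistribution F)
    (hG : IsDistribution G) (hL : MemL G) (hGF : WeakTailEquiv G F) :
    ∃ K : ENNReal, K < ⊤ ∧ ∀ t : ℝ, 0 < t →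
      atTop.limsup (fun x : ℝ => F (Ioi (x - t)) / F (Ioi x)) ≤ K := by
  obtain ⟨_, -, hpos⟩ := hF
  obtain ⟨c, hc0, hc⟩ := exists_between hGF.1
  obtain ⟨C, hC, hCtop⟩ := exists_between hGF.2
  refine ⟨2 * C / c, ENNReal.div_lt_top (ENNReal.mul_ne_top (by simp) hCtop.ne) hc0.ne',
    fun t ht => ?_⟩
  have hlower : ∀ᶠ x : ℝ in atTop, c < G (Ioi x) / F (Ioi x) := eventually_lt_of_lt_liminf hc
  have hupper : ∀ᶠ x : ℝ in atTop, G (Ioi x) / F (Ioi x) < C := eventually_lt_of_limsup_lt hC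
  have hshift : Tendsto (fun x : ℝ => x - t) atTop atTop :=
    tendsto_atTop_add_const_right _ (-t) tendsto_id
  refine limsup_le_of_le (by isBoundedDefault) ?_
  filter_upwards [hshift.eventually hlower, hupper, hL.eventually_measure_Ioi_sub_le hG ht]
    with x h₁ h₂ h₃
  have hFG : c * F (Ioi (x - t)) ≤ G (Ioi (x - t)) := ENNReal.mul_le_of_le_div h₁.le
  have hGF' : G (Ioi x) ≤ C * F (Ioi x) :=
    (ENNReal.div_le_iff (hpos x).ne' (measure_ne_top F _)).1 h₂.le
  rw [ENNReal.div_le_iff (hpos x).ne' (measure_ne_top F _), ENNReal.mul_comm_div, ← mul_div_assoc,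
    ENNReal.le_div_iff_mul_le (Or.inl hc0.ne') (Or.inl (hc.trans_le le_top).ne)]
  calc F (Ioi (x - t)) * c = c * F (Ioi (x - t)) := mul_comm _ _
    _ ≤ 2 * G (Ioi x) := hFG.trans h₃
    _ ≤ 2 * (C * F (Ioi x)) := by gcongr
    _ = 2 * C * F (Ioi x) := (mul_assoc _ _ _).symm

/-- Lemma 4.1: if `limsup_{t→∞} limsup_{x→∞} F̄(x-t)/F̄(x) = ∞` then `F` is
not weakly tail equivalent to any long-tailed distribution. -/
theorem not_weakEquiv_longTailed_of_double_limsup_top (F : Measure ℝ)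
    (hF : IsDistribution F)
    (h : Filter.atTop.limsup (fun t : ℝ =>
        Filter.atTop.limsup (fun x : ℝ => F (Set.Ioi (x - t)) / F (Set.Ioi x))) = ⊤) :
    ¬ ∃ G : Measure ℝ, IsDistribution G ∧ MemL G ∧ WeakTailEquiv G F := by
  rintro ⟨G, hG, hL, hGF⟩
  obtain ⟨K, hK, hle⟩ := hGF.exists_limsup_ratio_le hF hG hL
  refine (lt_of_le_of_lt ?_ hK).ne h
  exact limsup_le_of_le (by isBoundedDefault) ((eventually_gt_atTop 0).mono hle)
end
end

section
/- Fix constants α ∈ (0,1), β ∈ (α, 2α), x₁ > 2^{α/(β−α)}, and set x_{n+1} = x_n^{β/α} for n ≥ 1. Let F₁ be the distribution on [0,∞) with tail F̄₁(x) = 1 + (x₁^{−α} − 1)x/x₁ for 0 ≤ x < x₁, and F̄₁(x) = x_n^{−α} + (x_n^{−β} − x_n^{−α})(x − x_n)/(x_{n+1} − x_n) for x_n ≤ x < x_{n+1}, n ≥ 1. Then F₁ is subexponential: lim_{x→∞} F̄₁*²(x)/F̄₁(x) = 2. -/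
open MeasureTheory Filter Set Topology

noncomputable section

lemma conv2_Ioi (F : Measure ℝ) (t : ℝ) :
    conv2 F (Ioi t) = F.prod F {p : ℝ × ℝ | t < p.1 + p.2} := by
  rw [conv2, Measure.map_apply (by fun_prop) measurableSet_Ioi]
  rfl

lemma tail_nonneg (F : Measure ℝ) (t : ℝ) : 0 ≤ tail F t := ENNReal.toReal_nonneg

lemma tail_antitone (F : Measure ℝ) [IsProbabilityMeasure F] : Antitone (tail F) :=
  fun _ _ h => ENNReal.toReal_mono (measure_ne_top _ _) (measure_mono (Ioi_subset_Ioi h))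

lemma tendsto_tail_atTop (F : Measure ℝ) [IsProbabilityMeasure F] :
    Tendsto (tail F) atTop (𝓝 0) := by
  have h := (ProbabilityTheory.tendsto_cdf_atTop F).const_sub 1
  rw [sub_self] at h
  refine h.congr fun t => ?_
  rw [ProbabilityTheory.cdf_eq_real, ← probReal_compl_eq_one_sub measurableSet_Iic, compl_Iic]
  rfl

/-- If `X₁ + X₂ > t` then one of the summands exceeds `t - k`, or both exceed `k`. -/
lemma conv2_Ioi_le (F : Measure ℝ) [IsProbabilityMeasure F] (t k : ℝ) :
    (conv2 F (Ioi t)).toReal ≤ 2 * tail F (t - k) + tail F k ^ 2 := by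
  rw [conv2_Ioi]
  have hsub : {p : ℝ × ℝ | t < p.1 + p.2} ⊆
      (Ioi (t - k) ×ˢ univ ∪ univ ×ˢ Ioi (t - k)) ∪ Ioi k ×ˢ Ioi k := by
    rintro ⟨u, v⟩ h
    simp only [mem_ofPred_eq, mem_union, mem_prod, mem_Ioi, mem_univ, and_true, true_and] at h ⊢
    by_contra! hc
    obtain ⟨⟨h1, h2⟩, h3⟩ := hc
    have := h3 (by linarith)
    linarith
  have h1 := measureReal_mono (μ := F.prod F) hsub
  have h2 := measureReal_union_le (μ := F.prod F)
    (Ioi (t - k) ×ˢ univ ∪ univ ×ˢ Ioi (t - k)) (Ioi k ×ˢ Ioi k)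
  have h3 := measureReal_union_le (μ := F.prod F) (Ioi (t - k) ×ˢ univ) (univ ×ˢ Ioi (t - k))
  simp only [measureReal_prod_prod, probReal_univ, mul_one, one_mul] at h2 h3
  change (F.prod F).real _ ≤ 2 * F.real (Ioi (t - k)) + F.real (Ioi k) ^ 2
  linarith

/-- For nonnegative summands, `X₁ + X₂ > t` as soon as one of them exceeds `t`. -/
lemma le_conv2_Ioi (F : Measure ℝ) [IsProbabilityMeasure F] (hF : F (Iio 0) = 0) (t : ℝ) :
    2 * tail F t - tail F t ^ 2 ≤ (conv2 F (Ioi t)).toReal := by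
  rw [conv2_Ioi]
  have h0 : F.real (Ici 0) = 1 := by
    rw [← compl_Iio, probReal_compl_eq_one_sub measurableSet_Iio, Measure.real, hF]
    simp
  have hsub : Ioi t ×ˢ Ici 0 ∪ Ici 0 ×ˢ Ioi t ⊆ {p : ℝ × ℝ | t < p.1 + p.2} := by
    rintro ⟨u, v⟩ h
    simp only [mem_ofPred_eq, mem_union, mem_prod, mem_Ioi, mem_Ici] at h ⊢
    rcases h with h | h <;> linarith
  have hinter : Ioi t ×ˢ Ici 0 ∩ Ici 0 ×ˢ Ioi t ⊆ Ioi t ×ˢ Ioi t := fun p hp => ⟨hp.1.1, hp.2.2⟩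
  have h1 := measureReal_mono (μ := F.prod F) hsub
  have h2 := measureReal_mono (μ := F.prod F) hinter
  have h3 := measureReal_union_add_inter (μ := F.prod F) (s := Ioi t ×ˢ Ici (0 : ℝ))
    (t := Ici (0 : ℝ) ×ˢ Ioi t) (measurableSet_Ici.prod measurableSet_Ioi)
  simp only [measureReal_prod_prod, h0, mul_one, one_mul] at h2 h3
  change 2 * F.real (Ioi t) - F.real (Ioi t) ^ 2 ≤ (F.prod F).real _
  linarith

lemma MemS.of_eventually_le {F : Measure ℝ} (hF : IsDistribution F)
    (h : ∀ ε > 0, ∀ᶠ t in atTop, (conv2 F (Ioi t)).toReal ≤ (2 + ε) * tail F t) : MemS F := by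
  obtain ⟨hprob, h0, hpos⟩ := hF
  have htpos : ∀ t, 0 < tail F t := fun t => ENNReal.toReal_pos (hpos t).ne' (measure_ne_top _ _)
  refine tendsto_order.2 ⟨fun c hc => ?_, fun c hc => ?_⟩
  · filter_upwards [(tendsto_tail_atTop F).eventually_lt_const (sub_pos.2 hc)] with t ht
    rw [lt_div_iff₀ (htpos t)]
    nlinarith [le_conv2_Ioi F h0 t, htpos t]
  · filter_upwards [h ((c - 2) / 2) (by linarith)] with t ht
    rw [div_lt_iff₀ (htpos t)]
    nlinarith [htpos t]

/-- The upper half of subexponentiality for a tail that interpolates linearly between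
points at least doubling at each step. -/
lemma conv2_Ioi_le_of_piecewise_linear (F : Measure ℝ) [IsProbabilityMeasure F] {u v w t : ℝ}
    (hu : 0 < u) (huv : 2 * u ≤ v) (hvw : 4 * v ≤ w)
    (hlin₁ : ∀ y ∈ Icc u v, tail F y = tail F u + (tail F v - tail F u) * (y - u) / (v - u))
    (hlin₂ : ∀ y ∈ Icc v w, tail F y = tail F v + (tail F w - tail F v) * (y - v) / (w - v))
    (hut : 2 * u ≤ t) (htv : t ≤ 2 * v) :
    tail F v ≤ 2 * tail F t ∧
    (conv2 F (Ioi t)).toReal ≤ 2 * tail F t + 4 * tail F u * u / v + tail F u ^ 2 := by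
  have hv : 0 < v := by linarith
  have hvu : tail F v ≤ tail F u := tail_antitone F (by linarith)
  have hu0 := tail_nonneg F u
  have hv0 := tail_nonneg F v
  have hw0 := tail_nonneg F w
  have hwv : tail F w ≤ tail F v := tail_antitone F (by linarith)
  set s := (tail F u - tail F v) / (v - u) with hs
  set r := (tail F v - tail F w) / (w - v) with hr
  have hs' : s ≤ 2 * tail F u / v := by
    rw [hs, div_le_div_iff₀ (by linarith) hv]
    nlinarith
  have hr3 : r * v ≤ tail F v / 2 := by
    rw [hr, div_mul_eq_mul_div, div_le_iff₀ (by linarith)]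
    nlinarith
  have hr' : r ≤ 2 * tail F u / v := by
    rw [le_div_iff₀ hv]
    linarith
  have l₁ : ∀ y ∈ Icc u v, tail F y = tail F u - s * (y - u) := fun y hy => by
    rw [hlin₁ y hy, hs]; ring
  have l₂ : ∀ y ∈ Icc v w, tail F y = tail F v - r * (y - v) := fun y hy => by
    rw [hlin₂ y hy, hr]; ring
  have hsv := l₁ v ⟨by linarith, le_rfl⟩
  refine ⟨?_, ?_⟩
  · have h1 := l₂ (2 * v) ⟨by linarith, by linarith⟩
    have h2 := tail_antitone F htv
    nlinarith
  · have key : tail F (t - u) - tail F t ≤ 2 * tail F u / v * u := by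
      set g := 2 * tail F u / v
      rcases le_total t v with h | h
      · rw [l₁ t ⟨by linarith, h⟩, l₁ (t - u) ⟨by linarith, by linarith⟩]
        nlinarith
      · rw [l₂ t ⟨h, by linarith⟩]
        rcases le_total (t - u) v with h' | h'
        · rw [l₁ (t - u) ⟨by linarith, h'⟩]
          nlinarith [mul_le_mul_of_nonneg_right hs' (sub_nonneg.2 h'),
            mul_le_mul_of_nonneg_right hr' (sub_nonneg.2 h)]
        · rw [l₂ (t - u) ⟨h', by linarith⟩]
          nlinarith
    have h1 := conv2_Ioi_le F t u
    have h2 : 4 * tail F u * u / v = 2 * (2 * tail F u / v * u) := by ring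
    linarith

/-- Example 3.2, first part: the piecewise-linear distribution `F₁` built
from `α ∈ (0,1)`, `β ∈ (α, 2α)`, `x₁ > 2^{α/(β-α)}`, `x_{n+1} = x_n^{β/α}` is
subexponential. -/
theorem example32_subexponential (a b : ℝ) (ha0 : 0 < a) (ha1 : a < 1)
    (hab : a < b) (hb : b < 2 * a)
    (x : ℕ → ℝ) (hx1 : (2 : ℝ) ^ (a / (b - a)) < x 1)
    (hxrec : ∀ n : ℕ, 1 ≤ n → x (n + 1) = x n ^ (b / a))
    (F1 : Measure ℝ) (hF1 : IsDistribution F1)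
    (htail0 : ∀ y : ℝ, 0 ≤ y → y < x 1 →
      F1 (Set.Ioi y) = ENNReal.ofReal (1 + (x 1 ^ (-a) - 1) * y / x 1))
    (htail1 : ∀ n : ℕ, 1 ≤ n → ∀ y : ℝ, x n ≤ y → y < x (n + 1) →
      F1 (Set.Ioi y) = ENNReal.ofReal
        (x n ^ (-a) + (x n ^ (-b) - x n ^ (-a)) * (y - x n) / (x (n + 1) - x n))) :
    MemS F1 := by
  obtain ⟨hprob, h0, hpos⟩ := id hF1
  have hq : 0 < (b - a) / a := div_pos (by linarith) ha0
  have hc1 : 1 ≤ (2 : ℝ) ^ (a / (b - a)) :=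
    Real.one_le_rpow (by norm_num) (div_pos ha0 (by linarith)).le
  have hstep : ∀ n, 1 ≤ n → 0 < x n → x (n + 1) = x n * x n ^ ((b - a) / a) := by
    intro n hn hx
    rw [hxrec n hn, ← Real.rpow_one_add' hx.le (by positivity)]
    congr 1
    field_simp
    ring
  have hpow : ∀ y, (2 : ℝ) ^ (a / (b - a)) < y → 2 ≤ y ^ ((b - a) / a) := by
    intro y hy
    calc (2 : ℝ) = ((2 : ℝ) ^ (a / (b - a))) ^ ((b - a) / a) := by
          rw [← Real.rpow_mul (by norm_num), div_mul_div_cancel₀ (by linarith),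
            div_self ha0.ne', Real.rpow_one]
      _ ≤ y ^ ((b - a) / a) := Real.rpow_le_rpow (by linarith) hy.le hq.le
  have hlarge : ∀ n, 1 ≤ n → (2 : ℝ) ^ (a / (b - a)) < x n := by
    intro n hn
    induction n, hn using Nat.le_induction with
    | base => exact hx1
    | succ n hn ih =>
      rw [hstep n hn (by linarith)]
      nlinarith [hpow _ ih]
  have hone : ∀ n, 1 ≤ n → 1 < x n := fun n hn => hc1.trans_lt (hlarge n hn)
  have hdouble : ∀ n, 1 ≤ n → 2 * x n ≤ x (n + 1) := by
    intro n hn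
    rw [hstep n hn (by linarith [hone n hn])]
    nlinarith [hpow _ (hlarge n hn), hone n hn]
  have hxtop : Tendsto x atTop atTop := by
    have hgrow : ∀ n : ℕ, 1 ≤ n → (n : ℝ) ≤ x n := by
      intro n hn
      induction n, hn using Nat.le_induction with
      | base => exact_mod_cast (hone 1 le_rfl).le
      | succ n hn ih =>
        push_cast
        linarith [hdouble n hn, hone n hn]
    exact tendsto_atTop_mono' _ (eventually_atTop.2 ⟨1, hgrow⟩) tendsto_natCast_atTop_atTop
  have hnext : ∀ n, 1 ≤ n → x (n + 1) ^ (-a) = x n ^ (-b) := by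
    intro n hn
    rw [hxrec n hn, ← Real.rpow_mul (by linarith [hone n hn])]
    congr 1
    field_simp
  have hnode : ∀ n, 1 ≤ n → tail F1 (x n) = x n ^ (-a) := by
    intro n hn
    have hx := hone n hn
    rw [tail, htail1 n hn (x n) le_rfl (by linarith [hdouble n hn]), sub_self, mul_zero, zero_div,
      add_zero, ENNReal.toReal_ofReal (by positivity)]
  have hlin : ∀ n, 1 ≤ n → ∀ y ∈ Icc (x n) (x (n + 1)), tail F1 y = tail F1 (x n) +
      (tail F1 (x (n + 1)) - tail F1 (x n)) * (y - x n) / (x (n + 1) - x n) := by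
    intro n hn y hy
    have hx := hone n hn
    have hd := hdouble n hn
    rcases hy.2.eq_or_lt with rfl | hlt
    · rw [mul_div_assoc, div_self (by linarith)]
      ring
    · rw [hnode n hn, hnode (n + 1) (by lia), hnext n hn, tail, htail1 n hn y hy.1 hlt,
        ENNReal.toReal_ofReal]
      have hb0 : 0 ≤ x n ^ (-b) := by positivity
      have hba : x n ^ (-b) ≤ x n ^ (-a) := Real.rpow_le_rpow_of_exponent_le hx.le (by linarith)
      have hfrac : (y - x n) / (x (n + 1) - x n) ≤ 1 :=
        div_le_one_of_le₀ (by linarith) (by linarith)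
      rw [mul_div_assoc]
      nlinarith
  refine MemS.of_eventually_le hF1 fun ε hε => ?_
  have herr : Tendsto (fun y : ℝ => 8 * y ^ (-((b - a) * (1 / a - 1))) + 2 * y ^ (-(2 * a - b)))
      atTop (𝓝 0) := by
    have ha : 1 < 1 / a := by rwa [lt_div_iff₀ ha0, one_mul]
    simpa using ((tendsto_rpow_neg_atTop (mul_pos (sub_pos.2 hab) (sub_pos.2 ha))).const_mul 8).add
      ((tendsto_rpow_neg_atTop (sub_pos.2 hb)).const_mul 2)
  obtain ⟨N, hN⟩ := eventually_atTop.1 (((herr.comp hxtop).eventually_lt_const hε).and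
    (((tendsto_rpow_atTop hq).comp hxtop).eventually_ge_atTop 4))
  filter_upwards [eventually_ge_atTop (2 * x (N + 1))] with t ht
  obtain ⟨n, hn, hnt, htn⟩ : ∃ n, N + 1 ≤ n ∧ 2 * x n ≤ t ∧ t ≤ 2 * x (n + 1) := by
    have hex : ∃ m, t ≤ 2 * x (N + 1 + m + 1) := by
      obtain ⟨M, hM⟩ := eventually_atTop.1 (hxtop.eventually_ge_atTop (t / 2))
      exact ⟨M, by linarith [hM (N + 1 + M + 1) (by lia)]⟩
    classical
    refine ⟨N + 1 + Nat.find hex, by lia, ?_, Nat.find_spec hex⟩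
    rcases hm : Nat.find hex with _ | m
    · exact ht
    · exact (not_le.1 (Nat.find_min hex (m := m) (by lia))).le
  have hn1 : 1 ≤ n := by lia
  have hx := hone n hn1
  have hx' := hone (n + 1) (by lia)
  have hx0 : 0 < x n := by linarith
  have hfour : 4 * x (n + 1) ≤ x (n + 1 + 1) := by
    rw [hstep (n + 1) (by lia) (by linarith)]
    nlinarith [show 4 ≤ x (n + 1) ^ ((b - a) / a) from (hN (n + 1) (by lia)).2]
  obtain ⟨hlow, hup⟩ := conv2_Ioi_le_of_piecewise_linear F1 hx0 (hdouble n hn1) hfour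
    (hlin n hn1) (hlin (n + 1) (by lia)) hnt htn
  rw [hnode (n + 1) (by lia), hnext n hn1] at hlow
  rw [hnode n hn1] at hup
  have e1 : 4 * x n ^ (-a) * x n / x (n + 1) =
      4 * x n ^ (-((b - a) * (1 / a - 1))) * x n ^ (-b) := by
    have : x n ^ (-a) * x n / x (n + 1) = x n ^ (-((b - a) * (1 / a - 1))) * x n ^ (-b) := by
      rw [hxrec n hn1, ← Real.rpow_add_one hx0.ne', ← Real.rpow_sub hx0, ← Real.rpow_add hx0]
      congr 1
      field_simp
      ring
    linear_combination 4 * this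
  have e2 : (x n ^ (-a)) ^ 2 = x n ^ (-(2 * a - b)) * x n ^ (-b) := by
    rw [sq, ← Real.rpow_add hx0, ← Real.rpow_add hx0]
    congr 1
    ring
  have herr_lt : 8 * x n ^ (-((b - a) * (1 / a - 1))) + 2 * x n ^ (-(2 * a - b)) < ε :=
    (hN n (by lia)).1
  rw [e1, e2] at hup
  have hA : 0 ≤ x n ^ (-((b - a) * (1 / a - 1))) := by positivity
  have hB : 0 ≤ x n ^ (-(2 * a - b)) := by positivity
  have h2 := mul_le_mul_of_nonneg_left hlow (add_nonneg (mul_nonneg zero_le_four hA) hB)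
  have h3 := mul_le_mul_of_nonneg_right herr_lt.le (tail_nonneg F1 t)
  linarith
end
end

section
/- Fix constants α ∈ (0,1), β ∈ (α, 2α), x₁ > 2^{α/(β−α)}, and set x_{n+1} = x_n^{β/α} for n ≥ 1. Let F₁ be the distribution on [0,∞) with tail F̄₁(x) = 1 + (x₁^{−α} − 1)x/x₁ for 0 ≤ x < x₁, and F̄₁(x) = x_n^{−α} + (x_n^{−β} − x_n^{−α})(x − x_n)/(x_{n+1} − x_n) for x_n ≤ x < x_{n+1}, n ≥ 1. Then F₁ has infinite mean (∫₀^∞ F̄₁(y) dy = ∞), F₁ ∈ 𝒟𝒦₁ (indeed lim_{x→∞} x F̄₁(x) = ∞), and F₁ ∉ 𝒟 (indeed limsup_{x→∞} F̄₁(x/2)/F̄₁(x) = ∞). -/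
open MeasureTheory Filter Set Topology

noncomputable section

/-- The product of the linear interpolations of an increasing and a decreasing quantity is
bounded below by the smaller endpoint product. -/
lemma mul_le_mul_linear_interpolation {A B p q y : ℝ} (hAB : A < B) (hAy : A ≤ y) (hyB : y ≤ B)
    (hqp : q ≤ p) (hprod : A * p ≤ B * q) :
    A * p ≤ y * (p + (q - p) * (y - A) / (B - A)) := by
  have hpos : 0 < B - A := sub_pos.2 hAB
  set s := (y - A) / (B - A) with hs
  have hs0 : 0 ≤ s := div_nonneg (sub_nonneg.2 hAy) hpos.le
  have hs1 : s ≤ 1 := (div_le_one hpos).2 (by linarith)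
  have hy : y = A + s * (B - A) := by
    rw [hs, div_mul_cancel₀ _ hpos.ne']
    ring
  rw [mul_div_assoc, ← hs, hy]
  have h1 : 0 ≤ s * (1 - s) * ((B - A) * (p - q)) :=
    mul_nonneg (mul_nonneg hs0 (sub_nonneg.2 hs1)) (mul_nonneg hpos.le (sub_nonneg.2 hqp))
  have h2 : 0 ≤ s * (B * q - A * p) := mul_nonneg hs0 (sub_nonneg.2 hprod)
  linarith

/-- A sequence tending to infinity has, above any of its terms `x n ≤ y`, a consecutive pair
of terms enclosing `y`. -/
lemma exists_le_lt_succ_of_tendsto_atTop {x : ℕ → ℝ} (hx : Tendsto x atTop atTop) {n : ℕ} {y : ℝ}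
    (hy : x n ≤ y) : ∃ m, n ≤ m ∧ x m ≤ y ∧ y < x (m + 1) := by
  by_contra! h
  have hle : ∀ m, n ≤ m → x m ≤ y := fun m hm =>
    Nat.le_induction hy (fun k hk ih => h k hk ih) m hm
  obtain ⟨m, hm, hlt⟩ := ((eventually_ge_atTop n).and (hx.eventually_gt_atTop y)).exists
  exact (hle m hm).not_gt hlt

/-- If `y F̄(y) → ∞` then the mean, computed from the tail, is infinite. -/
lemma lintegral_tail_eq_top_of_tendsto (F : Measure ℝ) [IsProbabilityMeasure F]
    (h : Tendsto (fun y : ℝ => y * tail F y) atTop atTop) :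
    (∫⁻ y in Ioi (0 : ℝ), F (Ioi y) ∂volume) = ⊤ := by
  refine ENNReal.eq_top_of_forall_nnreal_le fun M => ?_
  obtain ⟨y, hM, hy⟩ := ((h.eventually_ge_atTop (M : ℝ)).and (eventually_ge_atTop 0)).exists
  calc (M : ENNReal) = ENNReal.ofReal M := by simp
    _ ≤ ENNReal.ofReal (y * tail F y) := ENNReal.ofReal_le_ofReal hM
    _ = F (Ioi y) * volume (Ioc 0 y) := by
      rw [ENNReal.ofReal_mul hy, tail, ENNReal.ofReal_toReal (measure_ne_top _ _), mul_comm]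
      simp
    _ = ∫⁻ _ in Ioc 0 y, F (Ioi y) ∂volume := by rw [setLIntegral_const]
    _ ≤ ∫⁻ z in Ioc 0 y, F (Ioi z) ∂volume :=
      setLIntegral_mono' measurableSet_Ioc fun z hz => measure_mono (Ioi_subset_Ioi hz.2)
    _ ≤ ∫⁻ z in Ioi (0 : ℝ), F (Ioi z) ∂volume := lintegral_mono_set Ioc_subset_Ioi_self

/-- The recursion `x (n + 1) = x n ^ (b / a)` at least doubles when started above
`2 ^ (a / (b - a))`. -/
lemma two_mul_le_of_rpow_recursion {a b : ℝ} (ha0 : 0 < a) (hab : a < b) {x : ℕ → ℝ}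
    (hx1 : (2 : ℝ) ^ (a / (b - a)) < x 1)
    (hxrec : ∀ n : ℕ, 1 ≤ n → x (n + 1) = x n ^ (b / a)) {n : ℕ} (hn : 1 ≤ n) :
    1 < x n ∧ 2 * x n ≤ x (n + 1) := by
  have hba : 0 < b - a := sub_pos.2 hab
  have hc : (1 : ℝ) < 2 ^ (a / (b - a)) :=
    Real.one_lt_rpow one_lt_two (div_pos ha0 hba)
  have double : ∀ m, 1 ≤ m → (2 : ℝ) ^ (a / (b - a)) < x m → 2 * x m ≤ x (m + 1) := by
    intro m hm hlt
    have hpos : 0 < x m := by linarith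
    have hexp : b / a = (b - a) / a + 1 := by field_simp; ring
    rw [hxrec m hm, hexp, Real.rpow_add_one hpos.ne']
    refine mul_le_mul_of_nonneg_right ?_ hpos.le
    calc (2 : ℝ) = ((2 : ℝ) ^ (a / (b - a))) ^ ((b - a) / a) := by
          rw [← Real.rpow_mul zero_le_two, div_mul_div_cancel₀ hba.ne', div_self ha0.ne',
            Real.rpow_one]
      _ ≤ x m ^ ((b - a) / a) :=
          Real.rpow_le_rpow (by linarith) hlt.le (div_pos hba ha0).le
  have large : (2 : ℝ) ^ (a / (b - a)) < x n := by
    induction n, hn using Nat.le_induction with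
    | base => exact hx1
    | succ m hm ih => linarith [double m hm ih]
  exact ⟨hc.trans large, double n hn large⟩

/-- Example 3.2, second part: the piecewise-linear distribution `F₁` built
from `α ∈ (0,1)`, `β ∈ (α, 2α)`, `x₁ > 2^{α/(β-α)}`, `x_{n+1} = x_n^{β/α}` has infinite
mean, lies in `𝒟𝒦₁` (indeed `x F̄₁(x) → ∞`), and is not in `𝒟`
(indeed `limsup F̄₁(x/2)/F̄₁(x) = ∞`). -/
theorem example32_infinite_mean_DK1_not_D (a b : ℝ) (ha0 : 0 < a) (ha1 : a < 1)
    (hab : a < b) (hb : b < 2 * a)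
    (x : ℕ → ℝ) (hx1 : (2 : ℝ) ^ (a / (b - a)) < x 1)
    (hxrec : ∀ n : ℕ, 1 ≤ n → x (n + 1) = x n ^ (b / a))
    (F1 : Measure ℝ) (hF1 : IsDistribution F1)
    (htail0 : ∀ y : ℝ, 0 ≤ y → y < x 1 →
      F1 (Set.Ioi y) = ENNReal.ofReal (1 + (x 1 ^ (-a) - 1) * y / x 1))
    (htail1 : ∀ n : ℕ, 1 ≤ n → ∀ y : ℝ, x n ≤ y → y < x (n + 1) →
      F1 (Set.Ioi y) = ENNReal.ofReal
        (x n ^ (-a) + (x n ^ (-b) - x n ^ (-a)) * (y - x n) / (x (n + 1) - x n))) :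
    (∫⁻ y in Set.Ioi (0 : ℝ), F1 (Set.Ioi y) ∂volume) = ⊤ ∧
    Filter.Tendsto (fun y : ℝ => y * tail F1 y) Filter.atTop Filter.atTop ∧
    MemDK1 F1 ∧
    Filter.atTop.limsup (fun y : ℝ => F1 (Set.Ioi (y / 2)) / F1 (Set.Ioi y)) = ⊤ ∧
    ¬ MemD F1 := by
  have := hF1.1
  have hx : ∀ n, 1 ≤ n → 1 < x n ∧ 2 * x n ≤ x (n + 1) := fun n hn =>
    two_mul_le_of_rpow_recursion ha0 hab hx1 hxrec hn
  have hpow : ∀ n, 1 ≤ n → x (n + 1) ^ (-a) = x n ^ (-b) := fun n hn => by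
    rw [hxrec n hn, ← Real.rpow_mul (by linarith [(hx n hn).1])]
    congr 1
    field_simp
  have hxtop : Tendsto x atTop atTop := by
    have hlow : ∀ n : ℕ, 1 ≤ n → (n : ℝ) ≤ x n := by
      intro n hn
      induction n, hn using Nat.le_induction with
      | base => simpa using (hx 1 le_rfl).1.le
      | succ m hm ih =>
        push_cast
        linarith [hx m hm]
    exact tendsto_atTop_mono' atTop ((eventually_ge_atTop 1).mono hlow)
      tendsto_natCast_atTop_atTop
  have hmul : ∀ z : ℝ, 0 < z → z * z ^ (-a) = z ^ (1 - a) := fun z hz => by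
    rw [sub_eq_add_neg, Real.rpow_add hz, Real.rpow_one]
  have hDK : Tendsto (fun y : ℝ => y * tail F1 y) atTop atTop := by
    have hpowtop : Tendsto (fun n => x n ^ (1 - a)) atTop atTop :=
      (tendsto_rpow_atTop (sub_pos.2 ha1)).comp hxtop
    refine tendsto_atTop.2 fun M => ?_
    obtain ⟨N, hN⟩ := eventually_atTop.1 (hpowtop.eventually_ge_atTop M)
    filter_upwards [eventually_ge_atTop (x (max N 1))] with y hy
    obtain ⟨m, hm, hmy, hym⟩ := exists_le_lt_succ_of_tendsto_atTop hxtop hy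
    have hm1 : 1 ≤ m := (le_max_right _ _).trans hm
    obtain ⟨h1, h2⟩ := hx m hm1
    have hxpos : 0 < x m := by linarith
    calc M ≤ x m ^ (1 - a) := hN m ((le_max_left _ _).trans hm)
      _ = x m * x m ^ (-a) := (hmul _ hxpos).symm
      _ ≤ y * (x m ^ (-a) + (x m ^ (-b) - x m ^ (-a)) * (y - x m) / (x (m + 1) - x m)) := by
        refine mul_le_mul_linear_interpolation (by linarith) hmy hym.le
          (Real.rpow_le_rpow_of_exponent_le h1.le (by linarith)) ?_
        rw [← hpow m hm1, hmul _ hxpos, hmul _ (by linarith)]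
        exact Real.rpow_le_rpow hxpos.le (by linarith) (sub_pos.2 ha1).le
      _ ≤ y * tail F1 y := by
        refine mul_le_mul_of_nonneg_left ?_ (by linarith)
        rw [tail, htail1 m hm1 y hmy hym, ENNReal.toReal_ofReal']
        exact le_max_left _ _
  have hlimsup : atTop.limsup (fun y : ℝ => F1 (Ioi (y / 2)) / F1 (Ioi y)) = ⊤ := by
    refine ENNReal.eq_top_of_forall_nnreal_le fun M => ?_
    refine le_limsup_of_frequently_le ?_
    have hpowtop : Tendsto (fun n => x n ^ (b - a)) atTop atTop :=
      (tendsto_rpow_atTop (sub_pos.2 hab)).comp hxtop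
    refine (hxtop.comp (tendsto_add_atTop_nat 1)).frequently (Eventually.frequently ?_)
    filter_upwards [hpowtop.eventually_ge_atTop (2 * (M : ℝ)), eventually_ge_atTop 1] with n hM hn
    obtain ⟨h1, h2⟩ := hx n hn
    have hstep := (hx (n + 1) (by omega)).2
    have hxpos : 0 < x n := by linarith
    have hp : 0 < x n ^ (-a) := Real.rpow_pos_of_pos hxpos _
    have hq : 0 < x n ^ (-b) := Real.rpow_pos_of_pos hxpos _
    have hd : 0 < x (n + 1) - x n := by linarith
    have htop : F1 (Ioi (x (n + 1))) = ENNReal.ofReal (x n ^ (-b)) := by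
      rw [htail1 (n + 1) (by omega) _ le_rfl (by linarith), hpow n hn]
      simp
    have hhalf : ENNReal.ofReal (x n ^ (-a) / 2) ≤ F1 (Ioi (x (n + 1) / 2)) := by
      rw [htail1 n hn _ (by linarith) (by linarith)]
      refine ENNReal.ofReal_le_ofReal ?_
      set t := (x (n + 1) / 2 - x n) / (x (n + 1) - x n) with ht
      have ht0 : 0 ≤ t := div_nonneg (by linarith) hd.le
      have ht1 : t ≤ 1 / 2 := (div_le_iff₀ hd).2 (by linarith)
      rw [mul_div_assoc, ← ht]
      nlinarith [mul_nonneg hq.le ht0, mul_nonneg hp.le (sub_nonneg.2 ht1)]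
    have hratio : (M : ℝ) * x n ^ (-b) ≤ x n ^ (-a) / 2 := by
      have hsplit : x n ^ (-a) = x n ^ (b - a) * x n ^ (-b) := by
        rw [← Real.rpow_add hxpos]
        congr 1
        ring
      rw [hsplit]
      nlinarith [mul_le_mul_of_nonneg_right hM hq.le]
    simp only [Function.comp_apply]
    rw [ENNReal.le_div_iff_mul_le (Or.inl (hF1.2.2 _).ne') (Or.inl (measure_ne_top _ _)), htop]
    refine le_trans ?_ hhalf
    rw [← ENNReal.ofReal_coe_nnreal, ← ENNReal.ofReal_mul M.coe_nonneg]
    exact ENNReal.ofReal_le_ofReal hratio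
  exact ⟨lintegral_tail_eq_top_of_tendsto F1 hDK, hDK, ⟨1, one_pos, by simpa using hDK⟩, hlimsup,
    fun h => h.ne hlimsup⟩
end
end

section
/- Fix constants α > 5 and x₁ > 4^α, and set x_{n+1} = x_n^{1+1/α} for n ≥ 1. Let F be the distribution on [0,∞) with tail F̄(x) = 1 + (x₁^{−α} − 1)x/x₁ for 0 ≤ x < x₁, F̄(x) = x_n^{−α} + (x_n^{−α−2} − x_n^{−α−1})(x − x_n) for x_n ≤ x < 2x_n, and F̄(x) = x_n^{−α−1} for 2x_n ≤ x < x_{n+1}, n ≥ 1. Then x^{−α−1} ≤ F̄(x) ≤ 2^α x^{−α} for all x ≥ x₁, and ∫₀^∞ y⁴ F̄(y) dy < ∞; in particular F ∈ 𝒟𝒦₁ and F has a finite mean. -/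
open MeasureTheory Filter Set Topology

noncomputable section

/-- If the probability measure `F` has a tail of order `y ^ (-a)` beyond `b`, then the moment
integral `∫ y ^ k F̄(y) dy` is finite whenever `k + 1 < a`. -/
lemma lintegral_pow_mul_tail_lt_top {F : Measure ℝ} [IsProbabilityMeasure F] {a b C : ℝ}
    (hb : 0 < b) (k : ℕ) (hk : k + 1 < a)
    (h : ∀ y, b ≤ y → tail F y ≤ C * y ^ (-a)) :
    (∫⁻ y in Ioi (0 : ℝ), ENNReal.ofReal (y ^ k) * F (Ioi y)) < ⊤ := by
  rw [← Ioc_union_Ioi_eq_Ioi hb.le]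
  refine (lintegral_union_le _ _ _).trans_lt (ENNReal.add_lt_top.2 ⟨?_, ?_⟩)
  · calc (∫⁻ y in Ioc 0 b, ENNReal.ofReal (y ^ k) * F (Ioi y))
        ≤ ∫⁻ _ in Ioc 0 b, ENNReal.ofReal (b ^ k) := by
          refine setLIntegral_mono measurable_const fun y hy => ?_
          refine (mul_le_of_le_one_right' prob_le_one).trans (ENNReal.ofReal_le_ofReal ?_)
          exact pow_le_pow_left₀ hy.1.le hy.2 k
      _ < ⊤ := by
          rw [setLIntegral_const, Real.volume_Ioc]
          exact ENNReal.mul_lt_top ENNReal.ofReal_lt_top ENNReal.ofReal_lt_top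
  · have hint : IntegrableOn (fun y : ℝ => C * y ^ ((k : ℝ) - a)) (Ioi b) :=
      (integrableOn_Ioi_rpow_of_lt (by linarith) hb).const_mul C
    refine lt_of_le_of_lt ?_ hint.lintegral_lt_top
    refine setLIntegral_mono' measurableSet_Ioi fun y hy => ?_
    have hy0 : 0 < y := hb.trans hy
    have hF : F (Ioi y) = ENNReal.ofReal (tail F y) :=
      (ENNReal.ofReal_toReal (measure_ne_top F _)).symm
    rw [hF, ← ENNReal.ofReal_mul (by positivity)]
    refine ENNReal.ofReal_le_ofReal ?_
    calc y ^ k * tail F y ≤ y ^ k * (C * y ^ (-a)) := by gcongr; exact h y (le_of_lt hy)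
      _ = C * y ^ ((k : ℝ) - a) := by
        rw [sub_eq_add_neg, Real.rpow_add hy0, Real.rpow_natCast]; ring

/-- A polynomial lower bound on the tail gives membership in `𝒟𝒦₁`. -/
lemma memDK1_of_rpow_le_tail {F : Measure ℝ} {a b : ℝ} (ha : 0 < a)
    (h : ∀ y, b ≤ y → y ^ (-a) ≤ tail F y) : MemDK1 F := by
  refine ⟨a + 1, by linarith, tendsto_atTop_mono' atTop ?_ tendsto_id⟩
  filter_upwards [eventually_ge_atTop b, eventually_gt_atTop 0] with y hyb hy
  calc id y = y ^ (a + 1) * y ^ (-a) := by rw [← Real.rpow_add hy]; simp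
    _ ≤ y ^ (a + 1) * tail F y := by gcongr; exact h y hyb

/-- A real sequence exceeding `4 ^ n` has every point `y ≥ x 1` in some interval
`[x n, x (n + 1))`. -/
lemma exists_mem_Ico_of_pow_le {x : ℕ → ℝ} (hx : ∀ n, 1 ≤ n → (4 : ℝ) ^ n ≤ x n) {y : ℝ}
    (hy : x 1 ≤ y) : ∃ n, 1 ≤ n ∧ y ∈ Ico (x n) (x (n + 1)) := by
  by_contra! hcon
  have hle : ∀ n, 1 ≤ n → x n ≤ y := fun n hn => by
    induction n, hn using Nat.le_induction with
    | base => exact hy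
    | succ n hn ih => exact not_lt.1 fun hlt => hcon n hn ⟨ih, hlt⟩
  obtain ⟨n, hn⟩ := pow_unbounded_of_one_lt y (by norm_num : (1 : ℝ) < 4)
  have h := (hx (n + 1) (by omega)).trans (hle (n + 1) (by omega))
  rw [pow_succ] at h
  linarith [pow_pos (by norm_num : (0 : ℝ) < 4) n]

/-- The recursion `x (n + 1) = x n ^ (1 + 1 / a)` started above `4 ^ a` grows at least
geometrically. -/
lemma four_pow_le_of_rpow_rec {a : ℝ} (ha : 1 ≤ a) {x : ℕ → ℝ} (hx1 : (4 : ℝ) ^ a < x 1)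
    (hxrec : ∀ n : ℕ, 1 ≤ n → x (n + 1) = x n ^ (1 + 1 / a)) {n : ℕ} (hn : 1 ≤ n) :
    (4 : ℝ) ^ n ≤ x n := by
  suffices h : (4 : ℝ) ^ a < x n ∧ (4 : ℝ) ^ n ≤ x n from h.2
  have h4a : (0 : ℝ) < 4 ^ a := by positivity
  induction n, hn using Nat.le_induction with
  | base =>
    refine ⟨hx1, le_trans ?_ hx1.le⟩
    simpa using Real.rpow_le_rpow_of_exponent_le (by norm_num : (1 : ℝ) ≤ 4) ha
  | succ n hn ih =>
    have h0 : 0 < x n := h4a.trans ih.1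
    have h4 : 4 ≤ x n ^ (1 / a) := by
      calc (4 : ℝ) = (4 ^ a) ^ (1 / a) := by
            rw [← Real.rpow_mul (by norm_num), mul_one_div_cancel (by linarith), Real.rpow_one]
        _ ≤ x n ^ (1 / a) := Real.rpow_le_rpow h4a.le ih.1.le (by positivity)
    rw [hxrec n hn, Real.rpow_add h0, Real.rpow_one, pow_succ]
    exact ⟨ih.1.trans_le (le_mul_of_one_le_right h0.le (by linarith)),
      mul_le_mul ih.2 h4 (by norm_num) h0.le⟩

/-- The linear interpolation between `c ^ (-a)` at `c` and `c ^ (-a - 1)` at `2 * c` stays between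
these two values. -/
lemma rpow_interpolation_bounds {a c y : ℝ} (hc : 1 ≤ c) (hcy : c ≤ y) (hy : y ≤ 2 * c) :
    c ^ (-a - 1) ≤ c ^ (-a) + (c ^ (-a - 2) - c ^ (-a - 1)) * (y - c) ∧
      c ^ (-a) + (c ^ (-a - 2) - c ^ (-a - 1)) * (y - c) ≤ c ^ (-a) := by
  have hc0 : 0 < c := by linarith
  have h1 : c ^ (-a) = c ^ (-a - 1) * c := by
    rw [← Real.rpow_add_one hc0.ne']; ring_nf
  have h2 : c ^ (-a - 1) = c ^ (-a - 2) * c := by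
    rw [← Real.rpow_add_one hc0.ne']; ring_nf
  have hle : c ^ (-a - 2) ≤ c ^ (-a - 1) :=
    Real.rpow_le_rpow_of_exponent_le hc (by linarith)
  constructor <;> nlinarith

/-- Example 3.3, tail bounds and moments: for the distribution of
Example 3.3 one has `x^{-α-1} ≤ F̄(x) ≤ 2^α x^{-α}` for all `x ≥ x₁` and
`∫₀^∞ y⁴ F̄(y) dy < ∞`; in particular `F ∈ 𝒟𝒦₁` and `F` has a finite mean. -/
theorem example33_tail_bounds (a : ℝ) (ha : 5 < a)
    (x : ℕ → ℝ) (hx1 : (4 : ℝ) ^ a < x 1)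
    (hxrec : ∀ n : ℕ, 1 ≤ n → x (n + 1) = x n ^ (1 + 1 / a))
    (F : Measure ℝ) (hF : IsDistribution F)
    (htail0 : ∀ y : ℝ, 0 ≤ y → y < x 1 →
      F (Set.Ioi y) = ENNReal.ofReal (1 + (x 1 ^ (-a) - 1) * y / x 1))
    (htail1 : ∀ n : ℕ, 1 ≤ n → ∀ y : ℝ, x n ≤ y → y < 2 * x n →
      F (Set.Ioi y) = ENNReal.ofReal
        (x n ^ (-a) + (x n ^ (-a - 2) - x n ^ (-a - 1)) * (y - x n)))
    (htail2 : ∀ n : ℕ, 1 ≤ n → ∀ y : ℝ, 2 * x n ≤ y → y < x (n + 1) →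
      F (Set.Ioi y) = ENNReal.ofReal (x n ^ (-a - 1))) :
    (∀ y : ℝ, x 1 ≤ y → y ^ (-a - 1) ≤ tail F y ∧ tail F y ≤ 2 ^ a * y ^ (-a)) ∧
    (∫⁻ y in Set.Ioi (0 : ℝ), ENNReal.ofReal (y ^ 4) * F (Set.Ioi y) ∂volume) < ⊤ ∧
    MemDK1 F ∧
    (∫⁻ y in Set.Ioi (0 : ℝ), F (Set.Ioi y) ∂volume) < ⊤ := by
  have := hF.1
  have hpow : ∀ n, 1 ≤ n → (4 : ℝ) ^ n ≤ x n := fun n hn =>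
    four_pow_le_of_rpow_rec (by linarith) hx1 hxrec hn
  have hone : ∀ n, 1 ≤ n → 1 ≤ x n := fun n hn =>
    (one_le_pow₀ (by norm_num)).trans (hpow n hn)
  have hbounds : ∀ y : ℝ, x 1 ≤ y → y ^ (-a - 1) ≤ tail F y ∧ tail F y ≤ 2 ^ a * y ^ (-a) := by
    intro y hy
    obtain ⟨n, hn, hny, hyn⟩ := exists_mem_Ico_of_pow_le hpow hy
    have hc : 1 ≤ x n := hone n hn
    have hc0 : 0 < x n := by linarith
    have hy0 : 0 < y := by linarith
    have hlow : y ^ (-a - 1) ≤ x n ^ (-a - 1) :=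
      Real.rpow_le_rpow_of_nonpos hc0 hny (by linarith)
    rcases lt_or_ge y (2 * x n) with hlt | hge
    · obtain ⟨hb1, hb2⟩ := rpow_interpolation_bounds (a := a) hc hny hlt.le
      rw [tail, htail1 n hn y hny hlt, ENNReal.toReal_ofReal (le_trans (by positivity) hb1)]
      refine ⟨hlow.trans hb1, hb2.trans ?_⟩
      calc x n ^ (-a) ≤ (y / 2) ^ (-a) :=
            Real.rpow_le_rpow_of_nonpos (by positivity) (by linarith) (by linarith)
        _ = 2 ^ a * y ^ (-a) := by
            rw [Real.div_rpow hy0.le (by norm_num), Real.rpow_neg (by norm_num : (0 : ℝ) ≤ 2),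
              div_inv_eq_mul, mul_comm]
    · rw [tail, htail2 n hn y hge hyn, ENNReal.toReal_ofReal (by positivity)]
      refine ⟨hlow, ?_⟩
      calc x n ^ (-a - 1) = x (n + 1) ^ (-a) := by
            rw [hxrec n hn, ← Real.rpow_mul hc0.le]
            congr 1
            field_simp
            ring
        _ ≤ y ^ (-a) := Real.rpow_le_rpow_of_nonpos hy0 hyn.le (by linarith)
        _ ≤ 2 ^ a * y ^ (-a) := le_mul_of_one_le_left (by positivity)
            (Real.one_le_rpow (by norm_num) (by linarith))
  have hx0 : 0 < x 1 := by linarith [hone 1 le_rfl]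
  have hmoment := fun (k : ℕ) (hk : (k : ℝ) + 1 < a) =>
    lintegral_pow_mul_tail_lt_top hx0 k hk fun y hy => (hbounds y hy).2
  refine ⟨hbounds, hmoment 4 (by norm_num; linarith), ?_, ?_⟩
  · refine memDK1_of_rpow_le_tail (a := a + 1) (b := x 1) (by linarith) fun y hy => ?_
    rw [neg_add']
    exact (hbounds y hy).1
  · simpa using hmoment 0 (by norm_num; linarith)
end
end

section
/- Fix constants α > 5 and x₁ > 4^α, and set x_{n+1} = x_n^{1+1/α} for n ≥ 1. Let F be the distribution on [0,∞) with tail F̄(x) = 1 + (x₁^{−α} − 1)x/x₁ for 0 ≤ x < x₁, F̄(x) = x_n^{−α} + (x_n^{−α−2} − x_n^{−α−1})(x − x_n) for x_n ≤ x < 2x_n, and F̄(x) = x_n^{−α−1} for 2x_n ≤ x < x_{n+1}, n ≥ 1. Then F̄(2x_n − 1)/F̄(2x_n) = 2 − x_n^{−1} → 2 as n → ∞, so F ∉ ℒ, and F̄(2x_n)/F̄(x_n) = x_n^{−1} → 0 as n → ∞, so F ∉ 𝒟. -/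
open MeasureTheory Filter Set Topology

noncomputable section

/-- If the ratio `F̄(u n - t) / F̄(u n)` converges to some `l ≠ 1` along a sequence `u n → ∞`,
then `F` is not long-tailed. -/
theorem not_memL_of_tendsto {F : Measure ℝ} {u : ℕ → ℝ} {t l : ℝ} (ht : 0 < t) (hl : l ≠ 1)
    (hu : Tendsto u atTop atTop)
    (h : Tendsto (fun n => tail F (u n - t) / tail F (u n)) atTop (𝓝 l)) : ¬ MemL F :=
  fun hL => hl (tendsto_nhds_unique h ((hL t ht).comp hu))

/-- If `F̄(u n) / F̄(2 u n) → ∞` along a sequence `u n → ∞`, then `F` is not dominatedly varying. -/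
theorem not_memD_of_tendsto {F : Measure ℝ} {u : ℕ → ℝ} (hu : Tendsto u atTop atTop)
    (h : Tendsto (fun n => F (Ioi (u n)) / F (Ioi (2 * u n))) atTop (𝓝 ⊤)) : ¬ MemD F := by
  intro hD
  obtain ⟨b, hb, hbt⟩ := exists_between hD
  have hlt := (hu.const_mul_atTop two_pos).eventually (eventually_lt_of_limsup_lt hb)
  have hgt := h.eventually (lt_mem_nhds hbt)
  obtain ⟨n, hn₁, hn₂⟩ := (hlt.and hgt).exists
  rw [mul_div_cancel_left₀ _ two_ne_zero] at hn₁
  exact lt_asymm hn₁ hn₂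

/-- The recursion `x (n + 1) = x n ^ (1 + 1 / a)` multiplies every `y > 4 ^ a` by at least `4`. -/
theorem four_mul_lt_rpow {a y : ℝ} (ha : 0 < a) (hy : (4 : ℝ) ^ a < y) :
    4 * y < y ^ (1 + 1 / a) := by
  have hy0 : 0 < y := (Real.rpow_pos_of_pos four_pos a).trans hy
  have h4 : 4 < y ^ (1 / a) := by
    have h := Real.rpow_lt_rpow (by positivity) hy (one_div_pos.2 ha)
    rwa [← Real.rpow_mul (by norm_num), mul_one_div_cancel ha.ne', Real.rpow_one] at h
  rw [Real.rpow_add hy0, Real.rpow_one, mul_comm]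
  gcongr

theorem four_rpow_lt_of_recursion {a : ℝ} (ha : 0 < a) {x : ℕ → ℝ} (hx1 : (4 : ℝ) ^ a < x 1)
    (hxrec : ∀ n : ℕ, 1 ≤ n → x (n + 1) = x n ^ (1 + 1 / a)) {n : ℕ} (hn : 1 ≤ n) :
    (4 : ℝ) ^ a < x n := by
  induction n, hn using Nat.le_induction with
  | base => exact hx1
  | succ n hn ih =>
    rw [hxrec n hn]
    linarith [four_mul_lt_rpow ha ih, Real.rpow_pos_of_pos (four_pos (α := ℝ)) a]

theorem tendsto_atTop_of_recursion {a : ℝ} (ha : 0 < a) {x : ℕ → ℝ} (hx1 : (4 : ℝ) ^ a < x 1)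
    (hxrec : ∀ n : ℕ, 1 ≤ n → x (n + 1) = x n ^ (1 + 1 / a)) : Tendsto x atTop atTop := by
  have hle : ∀ n : ℕ, 1 ≤ n → (n : ℝ) ≤ x n := by
    intro n hn
    induction n, hn using Nat.le_induction with
    | base => simpa using ((Real.one_lt_rpow (by norm_num) ha).trans hx1).le
    | succ n hn ih =>
      have h := four_mul_lt_rpow ha (four_rpow_lt_of_recursion ha hx1 hxrec hn)
      have hn' : (1 : ℝ) ≤ n := by exact_mod_cast hn
      rw [hxrec n hn]
      push_cast
      linarith
  refine tendsto_atTop_mono' _ ?_ tendsto_natCast_atTop_atTop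
  filter_upwards [eventually_ge_atTop 1] with n hn using hle n hn

/-- Example 3.3, not in ℒ ∪ 𝒟: for the distribution of Example 3.3 one has
`F̄(2x_n - 1)/F̄(2x_n) = 2 - x_n⁻¹ → 2`, so `F ∉ ℒ`, and
`F̄(2x_n)/F̄(x_n) = x_n⁻¹ → 0`, so `F ∉ 𝒟`. -/
theorem example33_not_L_not_D (a : ℝ) (ha : 5 < a)
    (x : ℕ → ℝ) (hx1 : (4 : ℝ) ^ a < x 1)
    (hxrec : ∀ n : ℕ, 1 ≤ n → x (n + 1) = x n ^ (1 + 1 / a))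
    (F : Measure ℝ) (hF : IsDistribution F)
    (htail0 : ∀ y : ℝ, 0 ≤ y → y < x 1 →
      F (Set.Ioi y) = ENNReal.ofReal (1 + (x 1 ^ (-a) - 1) * y / x 1))
    (htail1 : ∀ n : ℕ, 1 ≤ n → ∀ y : ℝ, x n ≤ y → y < 2 * x n →
      F (Set.Ioi y) = ENNReal.ofReal
        (x n ^ (-a) + (x n ^ (-a - 2) - x n ^ (-a - 1)) * (y - x n)))
    (htail2 : ∀ n : ℕ, 1 ≤ n → ∀ y : ℝ, 2 * x n ≤ y → y < x (n + 1) →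
      F (Set.Ioi y) = ENNReal.ofReal (x n ^ (-a - 1))) :
    (∀ n : ℕ, 1 ≤ n → tail F (2 * x n - 1) / tail F (2 * x n) = 2 - (x n)⁻¹) ∧
    Filter.Tendsto (fun n : ℕ => 2 - (x n)⁻¹) Filter.atTop (nhds 2) ∧
    ¬ MemL F ∧
    (∀ n : ℕ, 1 ≤ n → tail F (2 * x n) / tail F (x n) = (x n)⁻¹) ∧
    Filter.Tendsto (fun n : ℕ => (x n)⁻¹) Filter.atTop (nhds 0) ∧
    ¬ MemD F := by
  have ha0 : 0 < a := by linarith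
  have hbig : ∀ n, 1 ≤ n → (4 : ℝ) ^ a < x n :=
    fun n hn => four_rpow_lt_of_recursion ha0 hx1 hxrec hn
  have hone : ∀ n, 1 ≤ n → 1 < x n :=
    fun n hn => (Real.one_lt_rpow (by norm_num) ha0).trans (hbig n hn)
  have hxtop : Tendsto x atTop atTop := tendsto_atTop_of_recursion ha0 hx1 hxrec
  have hinv : Tendsto (fun n => (x n)⁻¹) atTop (𝓝 0) := hxtop.inv_tendsto_atTop
  have hlim : Tendsto (fun n => 2 - (x n)⁻¹) atTop (𝓝 2) := by
    simpa using hinv.const_sub 2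
  have hF_two : ∀ n, 1 ≤ n → F (Ioi (2 * x n)) = ENNReal.ofReal (x n ^ (-a - 1)) := by
    intro n hn
    refine htail2 n hn _ le_rfl ?_
    rw [hxrec n hn]
    linarith [four_mul_lt_rpow ha0 (hbig n hn), hone n hn]
  have hF_one : ∀ n, 1 ≤ n → F (Ioi (x n)) = ENNReal.ofReal (x n ^ (-a)) := by
    intro n hn
    rw [htail1 n hn _ le_rfl (by linarith [hone n hn]), sub_self, mul_zero, add_zero]
  have hpow_two : ∀ n, 1 ≤ n → x n ^ (-a - 2) = x n ^ (-a) / x n ^ 2 := by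
    intro n hn
    rw [Real.rpow_sub (by linarith [hone n hn]), Real.rpow_two]
  have hpow_one : ∀ n, 1 ≤ n → x n ^ (-a - 1) = x n ^ (-a) / x n := by
    intro n hn
    rw [Real.rpow_sub_one (by linarith [hone n hn])]
  have hratioL : ∀ n, 1 ≤ n → tail F (2 * x n - 1) / tail F (2 * x n) = 2 - (x n)⁻¹ := by
    intro n hn
    have h1 := hone n hn
    have h0 : 0 < x n := by linarith
    have hp : 0 < x n ^ (-a) := Real.rpow_pos_of_pos h0 _
    have hval : x n ^ (-a) + (x n ^ (-a - 2) - x n ^ (-a - 1)) * (2 * x n - 1 - x n)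
        = x n ^ (-a) / x n * (2 - (x n)⁻¹) := by
      rw [hpow_two n hn, hpow_one n hn]
      field_simp
      ring
    have h2 : 0 ≤ 2 - (x n)⁻¹ := by linarith [inv_le_one_of_one_le₀ h1.le]
    rw [tail, tail, htail1 n hn _ (by linarith) (by linarith), hF_two n hn, hval, hpow_one n hn,
      ENNReal.toReal_ofReal (by positivity), ENNReal.toReal_ofReal (by positivity)]
    field_simp
  have hratioD : ∀ n, 1 ≤ n → tail F (2 * x n) / tail F (x n) = (x n)⁻¹ := by
    intro n hn
    have h0 : 0 < x n := by linarith [hone n hn]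
    have hp : 0 < x n ^ (-a) := Real.rpow_pos_of_pos h0 _
    rw [tail, tail, hF_two n hn, hF_one n hn, hpow_one n hn,
      ENNReal.toReal_ofReal (by positivity), ENNReal.toReal_ofReal (by positivity)]
    field_simp
  refine ⟨hratioL, hlim, ?_, hratioD, hinv, ?_⟩
  · refine not_memL_of_tendsto one_pos (l := 2) (by norm_num)
      (hxtop.const_mul_atTop two_pos) (hlim.congr' ?_)
    filter_upwards [eventually_ge_atTop 1] with n hn using (hratioL n hn).symm
  · refine not_memD_of_tendsto hxtop ((ENNReal.tendsto_ofReal_atTop.comp hxtop).congr' ?_)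
    filter_upwards [eventually_ge_atTop 1] with n hn
    have h0 : 0 < x n := by linarith [hone n hn]
    have hp : 0 < x n ^ (-a) := Real.rpow_pos_of_pos h0 _
    rw [hF_two n hn, hF_one n hn, hpow_one n hn, ← ENNReal.ofReal_div_of_pos (by positivity),
      Function.comp_apply]
    congr 1
    field_simp
end
end
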